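/- Let (Ω,σ) be a bounded one-sided NTA pair of mixed dimension in ℝ^n with n ≥ 3, let a > 0, let Y ∈ Ω, and let u be a solution with pole at Y and vanishing Robin condition (parameter a). Then there is a constant C > 0, depending only on n (in particular not on a, Y, r, or Ω), such that for every 0 < r < diam(Ω): ∫_{Ω ∖ B(Y,2r)} |∇u|² dX ≤ C·r^{−2} ∫_{Ω ∩ B(Y,2r) ∖ B(Y,r)} u² dX. -/

import Mathlib

open MeasureTheory Metric Set
open scoped RealInnerProductSpace ENNReal NNReal Topology

noncomputable section

/-- The (second-order) Laplacian-based notion of harmonicity: `u` is `C²` near each point of `S`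
and its Laplacian (the sum of pure second derivatives) vanishes on `S`. -/
def IsHarmonicOn {n : ℕ} (u : EuclideanSpace ℝ (Fin n) → ℝ)
    (S : Set (EuclideanSpace ℝ (Fin n))) : Prop :=
  ∀ x ∈ S, ContDiffAt ℝ 2 u x ∧
    ∑ i : Fin n, iteratedFDeriv ℝ 2 u x ![EuclideanSpace.single i (1 : ℝ),
      EuclideanSpace.single i (1 : ℝ)] = 0

/-- One-sided NTA conditions (C1) interior corkscrew and (C2) Harnack chains, with constant `M`. -/
structure IsOneSidedNTA {n : ℕ} (M : ℝ) (Ω : Set (EuclideanSpace ℝ (Fin n))) : Prop where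
  isOpen : IsOpen Ω
  M_gt_one : 1 < M
  corkscrew : ∀ Q ∈ frontier Ω, ∀ r : ℝ, 0 < r → r < Metric.diam Ω / 10 →
    ∃ A ∈ Ω ∩ ball Q r, r / M ≤ infDist A (frontier Ω)
  harnack : ∀ r ε : ℝ, ∀ k : ℕ, 0 < r → r < Metric.diam Ω / 10 → 0 < ε → 1 ≤ k →
    ∀ x ∈ Ω, ∀ y ∈ Ω, dist x y = r → ε ≤ infDist x (frontier Ω) →
      ε ≤ infDist y (frontier Ω) → r ≤ 2 ^ k * ε →
      ∃ (c : ℕ → EuclideanSpace ℝ (Fin n)) (ρ : ℕ → ℝ),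
        c 1 = x ∧ c ⌈M * (k : ℝ)⌉₊ = y ∧
        ∀ i : ℕ, 1 ≤ i → i ≤ ⌈M * (k : ℝ)⌉₊ →
          0 < ρ i ∧ ρ i ≤ infDist (c i) (frontier Ω) / 10 ∧ ball (c i) (ρ i) ⊆ Ω ∧
          (i < ⌈M * (k : ℝ)⌉₊ → c (i + 1) ∈ ball (c i) (ρ i))

/-- A bounded one-sided NTA pair of mixed dimension, with geometric constants `M, Cσ, d, cd`. -/
structure IsMixedPair {n : ℕ} (M Cσ d cd : ℝ) (Ω : Set (EuclideanSpace ℝ (Fin n)))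
    (σ : Measure (EuclideanSpace ℝ (Fin n))) : Prop where
  nta : IsOneSidedNTA M Ω
  bounded : Bornology.IsBounded Ω
  nonempty : Ω.Nonempty
  supp_pos : ∀ Q ∈ frontier Ω, ∀ r : ℝ, 0 < r → 0 < σ (ball Q r)
  null_outside : σ (frontier Ω)ᶜ = 0
  finite : σ (frontier Ω) ≠ ⊤
  Cσ_pos : 0 < Cσ
  doubling : ∀ Q ∈ frontier Ω, ∀ r : ℝ, 0 < r → r < Metric.diam Ω →
    (σ (ball Q (2 * r))).toReal ≤ Cσ * (σ (ball Q r)).toReal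
  d_gt : (n : ℝ) - 2 < d
  cd_pos : 0 < cd
  lower_dim : ∀ Q ∈ frontier Ω, ∀ r s : ℝ, 0 < s → s < r → r < Metric.diam Ω →
    cd * (r / s) ^ d * (σ (ball Q s)).toReal ≤ (σ (ball Q r)).toReal

/-- A Robin Green function for the Laplacian on `(Ω, σ)` with parameter `a`. -/
structure IsRobinGreen {n : ℕ} (Ω : Set (EuclideanSpace ℝ (Fin n)))
    (σ : Measure (EuclideanSpace ℝ (Fin n))) (a : ℝ)
    (G : EuclideanSpace ℝ (Fin n) → EuclideanSpace ℝ (Fin n) → ℝ) : Prop where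
  symm : ∀ X ∈ Ω, ∀ Y ∈ Ω, X ≠ Y → G X Y = G Y X
  nonneg : ∀ Y ∈ Ω, ∀ X ∈ closure Ω \ {Y}, 0 ≤ G X Y
  contOn : ∀ Y ∈ Ω, ContinuousOn (fun X => G X Y) (closure Ω \ {Y})
  harmonic : ∀ Y ∈ Ω, IsHarmonicOn (fun X => G X Y) (Ω \ {Y})
  grad_L2 : ∀ Y ∈ Ω, ∀ r : ℝ, 0 < r →
    IntegrableOn (fun X => ‖gradient (fun Z => G Z Y) X‖ ^ 2) (Ω \ ball Y r) volume
  grad_L1 : ∀ Y ∈ Ω, IntegrableOn (fun X => ‖gradient (fun Z => G Z Y) X‖) Ω volume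
  weak : ∀ Y ∈ Ω, ∀ φ : EuclideanSpace ℝ (Fin n) → ℝ,
    ContDiff ℝ (⊤ : ℕ∞) φ → HasCompactSupport φ →
    (∫ X in Ω, ⟪gradient (fun Z => G Z Y) X, gradient φ X⟫) +
      a * ∫ P in frontier Ω, G P Y * φ P ∂σ = φ Y

/-- A Dirichlet Green function for the Laplacian on `Ω`. -/
structure IsDirichletGreen {n : ℕ} (Ω : Set (EuclideanSpace ℝ (Fin n)))
    (G : EuclideanSpace ℝ (Fin n) → EuclideanSpace ℝ (Fin n) → ℝ) : Prop where
  nonneg : ∀ Y ∈ Ω, ∀ X ∈ closure Ω \ {Y}, 0 ≤ G X Y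
  contOn : ∀ Y ∈ Ω, ContinuousOn (fun X => G X Y) (closure Ω \ {Y})
  boundary_zero : ∀ Y ∈ Ω, ∀ Q ∈ frontier Ω, G Q Y = 0
  harmonic : ∀ Y ∈ Ω, IsHarmonicOn (fun X => G X Y) (Ω \ {Y})
  grad_L2 : ∀ Y ∈ Ω, ∀ r : ℝ, 0 < r →
    IntegrableOn (fun X => ‖gradient (fun Z => G Z Y) X‖ ^ 2) (Ω \ ball Y r) volume
  grad_L1 : ∀ Y ∈ Ω, IntegrableOn (fun X => ‖gradient (fun Z => G Z Y) X‖) Ω volume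
  weak : ∀ Y ∈ Ω, ∀ φ : EuclideanSpace ℝ (Fin n) → ℝ,
    ContDiff ℝ (⊤ : ℕ∞) φ → HasCompactSupport φ → tsupport φ ⊆ Ω →
    (∫ X in Ω, ⟪gradient (fun Z => G Z Y) X, gradient φ X⟫) = φ Y

/-- A solution with pole at `Y` and vanishing Robin condition (parameter `a`). -/
structure IsRobinPoleSolution {n : ℕ} (Ω : Set (EuclideanSpace ℝ (Fin n)))
    (σ : Measure (EuclideanSpace ℝ (Fin n))) (a : ℝ) (Y : EuclideanSpace ℝ (Fin n))
    (u : EuclideanSpace ℝ (Fin n) → ℝ) : Prop where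
  contOn : ContinuousOn u (closure Ω \ {Y})
  harmonic : IsHarmonicOn u (Ω \ {Y})
  grad_L2 : ∀ r : ℝ, 0 < r → IntegrableOn (fun X => ‖gradient u X‖ ^ 2) (Ω \ ball Y r) volume
  weak : ∀ φ : EuclideanSpace ℝ (Fin n) → ℝ,
    ContDiff ℝ (⊤ : ℕ∞) φ → HasCompactSupport φ → Y ∉ tsupport φ →
    (∫ X in Ω, ⟪gradient u X, gradient φ X⟫) + a * ∫ P in frontier Ω, u P * φ P ∂σ = 0

/-- A nonnegative weak solution of the homogeneous Robin problem in `B(Q, ρ)` (parameter `a`). -/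
structure IsRobinLocalSolution {n : ℕ} (Ω : Set (EuclideanSpace ℝ (Fin n)))
    (σ : Measure (EuclideanSpace ℝ (Fin n))) (a : ℝ) (Q : EuclideanSpace ℝ (Fin n)) (ρ : ℝ)
    (u : EuclideanSpace ℝ (Fin n) → ℝ) : Prop where
  nonneg : ∀ X ∈ closure Ω ∩ ball Q ρ, 0 ≤ u X
  contOn : ContinuousOn u (closure Ω ∩ ball Q ρ)
  harmonic : IsHarmonicOn u (Ω ∩ ball Q ρ)
  grad_L2 : ∀ ρ' : ℝ, ρ' < ρ →
    IntegrableOn (fun X => ‖gradient u X‖ ^ 2) (Ω ∩ ball Q ρ') volume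
  weak : ∀ φ : EuclideanSpace ℝ (Fin n) → ℝ,
    ContDiff ℝ (⊤ : ℕ∞) φ → HasCompactSupport φ → tsupport φ ⊆ ball Q ρ →
    (∫ X in Ω, ⟪gradient u X, gradient φ X⟫) + a * ∫ P in frontier Ω, u P * φ P ∂σ = 0

/-- A flux solution: `u = 1` on `cl B(0,1)`, harmonic outside, homogeneous Robin condition. -/
structure IsFluxSolution {n : ℕ} (Ω : Set (EuclideanSpace ℝ (Fin n)))
    (σ : Measure (EuclideanSpace ℝ (Fin n))) (a : ℝ)
    (u : EuclideanSpace ℝ (Fin n) → ℝ) : Prop where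
  contOn : ContinuousOn u (closure Ω)
  one_on_ball : ∀ X ∈ closedBall (0 : EuclideanSpace ℝ (Fin n)) 1, u X = 1
  harmonic : IsHarmonicOn u (Ω \ closedBall (0 : EuclideanSpace ℝ (Fin n)) 1)
  grad_L2 : IntegrableOn (fun X => ‖gradient u X‖ ^ 2)
    (Ω \ closedBall (0 : EuclideanSpace ℝ (Fin n)) 1) volume
  weak : ∀ φ : EuclideanSpace ℝ (Fin n) → ℝ,
    ContDiff ℝ (⊤ : ℕ∞) φ → HasCompactSupport φ →
    tsupport φ ⊆ (closedBall (0 : EuclideanSpace ℝ (Fin n)) 1)ᶜ →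
    (∫ X in Ω, ⟪gradient u X, gradient φ X⟫) + a * ∫ P in frontier Ω, u P * φ P ∂σ = 0

/-- A Dirichlet harmonic measure for `Ω`: a family of probability measures on `∂Ω` solving the
Dirichlet problem for continuous boundary data. -/
structure IsDirichletHM {n : ℕ} (Ω : Set (EuclideanSpace ℝ (Fin n)))
    (ω : EuclideanSpace ℝ (Fin n) → Measure (EuclideanSpace ℝ (Fin n))) : Prop where
  prob : ∀ X ∈ Ω, IsProbabilityMeasure (ω X)
  supported : ∀ X ∈ Ω, (ω X) (frontier Ω)ᶜ = 0
  solves : ∀ f : EuclideanSpace ℝ (Fin n) → ℝ, ContinuousOn f (frontier Ω) →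
    ∃ h : EuclideanSpace ℝ (Fin n) → ℝ,
      ContinuousOn h (closure Ω) ∧ IsHarmonicOn h Ω ∧
      (∀ X ∈ Ω, h X = ∫ y, f y ∂(ω X)) ∧ (∀ Q ∈ frontier Ω, h Q = f Q)

end

namespace RobinCacc

section A
set_option linter.unusedSectionVars false
variable {E : Type*} [NormedAddCommGroup E] [InnerProductSpace ℝ E] [FiniteDimensional ℝ E]
  [MeasurableSpace E] [BorelSpace E]

lemma seg_est {w : E → ℝ} {Ω : Set E} (hw : ∀ x ∈ Ω, ContDiffAt ℝ 1 w x) (a b : E)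
    (hseg : ∀ t ∈ Icc (0:ℝ) 1, a + t • (b - a) ∈ Ω) :
    ENNReal.ofReal ((w b - w a) ^ 2) ≤ ENNReal.ofReal (‖b - a‖ ^ 2) *
      ∫⁻ t in Icc (0:ℝ) 1, ENNReal.ofReal (‖fderiv ℝ w (a + t • (b - a))‖ ^ 2) := by
  have hγ : Continuous (fun t : ℝ => a + t • (b - a)) := by fun_prop
  have hcD : ContinuousOn (fun t : ℝ => fderiv ℝ w (a + t • (b - a))) (Icc 0 1) := by
    intro t ht
    have h1 : ContinuousAt (fderiv ℝ w) (a + t • (b - a)) :=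
      (hw _ (hseg t ht)).continuousAt_fderiv one_ne_zero
    exact (ContinuousAt.comp (f := fun t : ℝ => a + t • (b - a)) h1 hγ.continuousAt).continuousWithinAt
  have hch : ContinuousOn (fun t : ℝ => fderiv ℝ w (a + t • (b - a)) (b - a)) (Icc 0 1) :=
    hcD.clm_apply continuousOn_const
  have hI : Icc (0:ℝ) 1 = uIcc 0 1 := by rw [uIcc_of_le zero_le_one]
  set h : ℝ → ℝ := fun t => fderiv ℝ w (a + t • (b - a)) (b - a) with hh
  have hftc : ∫ t in (0:ℝ)..1, h t = w b - w a := by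
    have := intervalIntegral.integral_eq_sub_of_hasDerivAt (a := (0:ℝ)) (b := 1)
      (f := fun t => w (a + t • (b - a))) (f' := h) (by
        intro t ht
        rw [← hI] at ht
        have h1 : HasFDerivAt w (fderiv ℝ w (a + t • (b - a))) (a + t • (b - a)) :=
          ((hw _ (hseg t ht)).differentiableAt one_ne_zero).hasFDerivAt
        have h2 : HasDerivAt (fun t : ℝ => a + t • (b - a)) (b - a) t := by
          simpa using ((hasDerivAt_id t).smul_const (b - a)).const_add a
        exact h1.comp_hasDerivAt t h2)
      ((hI ▸ hch).intervalIntegrable)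
    simpa using this
  have i1 : IntervalIntegrable h volume 0 1 := (hI ▸ hch).intervalIntegrable
  have i2 : IntervalIntegrable (fun t => h t ^ 2) volume 0 1 := (hI ▸ (hch.pow 2)).intervalIntegrable
  have i3 : IntervalIntegrable (fun t => ‖b - a‖ ^ 2 * ‖fderiv ℝ w (a + t • (b - a))‖ ^ 2) volume 0 1 :=
    (hI ▸ (continuousOn_const.mul (hcD.norm.pow 2))).intervalIntegrable
  set m := w b - w a with hm
  have hjen : m ^ 2 ≤ ∫ t in (0:ℝ)..1, h t ^ 2 := by
    have h0 : 0 ≤ ∫ t in (0:ℝ)..1, (h t - m) ^ 2 :=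
      intervalIntegral.integral_nonneg zero_le_one (fun t _ => sq_nonneg _)
    have : ∫ t in (0:ℝ)..1, (h t - m) ^ 2 = (∫ t in (0:ℝ)..1, h t ^ 2) - 2 * m * m + m ^ 2 := by
      have e : ∀ t, (h t - m) ^ 2 = h t ^ 2 - 2 * m * h t + m ^ 2 := fun t => by ring
      simp_rw [e]
      rw [intervalIntegral.integral_add (i2.sub (i1.const_mul _)) (by simp),
        intervalIntegral.integral_sub i2 (i1.const_mul _), intervalIntegral.integral_const_mul, hftc]
      simp
    nlinarith
  have hle : m ^ 2 ≤ ∫ t in (0:ℝ)..1, ‖b - a‖ ^ 2 * ‖fderiv ℝ w (a + t • (b - a))‖ ^ 2 := by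
    refine hjen.trans (intervalIntegral.integral_mono_on zero_le_one i2 i3 fun t _ => ?_)
    have := (fderiv ℝ w (a + t • (b - a))).le_opNorm (b - a)
    rw [← mul_pow, ← sq_abs, mul_comm]
    exact pow_le_pow_left₀ (abs_nonneg _) this 2
  rw [intervalIntegral.integral_const_mul, intervalIntegral.integral_of_le zero_le_one,
    ← integral_Icc_eq_integral_Ioc] at hle
  refine (ENNReal.ofReal_le_ofReal hle).trans ?_
  rw [ENNReal.ofReal_mul (by positivity), ofReal_integral_eq_lintegral_ofReal]
  · exact (hcD.norm.pow 2).integrableOn_Icc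
  · exact Filter.Eventually.of_forall fun t => by positivity

lemma chain_est {w : E → ℝ} {Ω : Set E} (hw : ∀ x ∈ Ω, ContDiffAt ℝ 1 w x) (x : ℕ → E) (N : ℕ)
    (l : ℝ) (hstep : ∀ i < N, ‖x (i+1) - x i‖ ≤ l)
    (hseg : ∀ i < N, ∀ t ∈ Icc (0:ℝ) 1, x i + t • (x (i+1) - x i) ∈ Ω) :
    ENNReal.ofReal ((w (x N) - w (x 0)) ^ 2) ≤ ENNReal.ofReal (N * l ^ 2) *
      ∑ i ∈ Finset.range N, ∫⁻ t in Icc (0:ℝ) 1,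
        ENNReal.ofReal (‖fderiv ℝ w (x i + t • (x (i+1) - x i))‖ ^ 2) := by
  have h1 : (w (x N) - w (x 0)) ^ 2 ≤ N * ∑ i ∈ Finset.range N, (w (x (i+1)) - w (x i)) ^ 2 := by
    rw [← Finset.sum_range_sub (fun i => w (x i)) N]
    simpa using sq_sum_le_card_mul_sum_sq (s := Finset.range N)
      (f := fun i => w (x (i+1)) - w (x i))
  refine (ENNReal.ofReal_le_ofReal h1).trans ?_
  rw [ENNReal.ofReal_mul (by positivity), ENNReal.ofReal_mul (by positivity), mul_assoc,
    ENNReal.ofReal_sum_of_nonneg (fun _ _ => sq_nonneg _)]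
  refine mul_le_mul_right ?_ _
  rw [Finset.mul_sum]
  refine Finset.sum_le_sum fun i hi => ?_
  have hi := Finset.mem_range.1 hi
  refine (seg_est hw (x i) (x (i+1)) (hseg i hi)).trans ?_
  gcongr
  exact hstep i hi

lemma measurable_energy (w : E → ℝ) :
    Measurable (fun z => ENNReal.ofReal (‖fderiv ℝ w z‖ ^ 2)) := by
  have := (measurable_fderiv ℝ w).norm.pow_const 2
  exact this.ennreal_ofReal

lemma pair_est {w : E → ℝ} {Ω : Set E} (hΩ : IsOpen Ω) (hw : ∀ x ∈ Ω, ContDiffAt ℝ 1 w x)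
    (x : ℕ → E) (N : ℕ)
    (l ρ D : ℝ) (p q : E) (hp : x 0 = p) (hq : x N = q) (hstep : ∀ i < N, ‖x (i+1) - x i‖ ≤ l)
    (hseg : ∀ i < N, ∀ t ∈ Icc (0:ℝ) 1, ball (x i + t • (x (i+1) - x i)) ρ ⊆ Ω ∩ ball p D) :
    ∫⁻ v in ball (0:E) ρ, ENNReal.ofReal ((w (q + v) - w (p + v)) ^ 2) ≤
      ENNReal.ofReal (N * l ^ 2) * (N *
      ∫⁻ z in Ω ∩ ball p D, ENNReal.ofReal (‖fderiv ℝ w z‖ ^ 2)) := by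
  set G : E → ℝ≥0∞ := fun z => ENNReal.ofReal (‖fderiv ℝ w z‖ ^ 2) with hG
  have hGm : Measurable G := measurable_energy w
  have key : ∀ v ∈ ball (0:E) ρ, ENNReal.ofReal ((w (q + v) - w (p + v)) ^ 2) ≤
      ENNReal.ofReal (N * l ^ 2) * ∑ i ∈ Finset.range N, ∫⁻ t in Icc (0:ℝ) 1,
        G (x i + t • (x (i+1) - x i) + v) := by
    intro v hv
    have := chain_est hw (fun i => x i + v) N l (by simpa using hstep) (by
      intro i hi t ht
      apply (hseg i hi t ht _).1
      rw [mem_ball_iff_norm] at hv ⊢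
      have : x i + v + t • (x (i + 1) + v - (x i + v)) - (x i + t • (x (i+1) - x i)) = v - 0 := by
        simp
      rwa [this])
    simp only [hp, hq] at this
    refine this.trans (le_of_eq ?_)
    congr 1
    refine Finset.sum_congr rfl fun i _ => lintegral_congr fun t => ?_
    simp only [hG]
    congr 4
    simp; abel
  refine (setLIntegral_mono' measurableSet_ball key).trans ?_
  have hm : ∀ i, Measurable (Function.uncurry fun (v : E) (t : ℝ) => G (x i + t • (x (i+1) - x i) + v)) := by
    intro i
    apply hGm.comp
    fun_prop
  rw [lintegral_const_mul' _ _ ENNReal.ofReal_ne_top, lintegral_finsetSum']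
  swap
  · intro i _
    exact (Measurable.lintegral_prod_right (hm i)).aemeasurable
  gcongr
  have : ∀ i ∈ Finset.range N, ∫⁻ v in ball (0:E) ρ, ∫⁻ t in Icc (0:ℝ) 1,
      G (x i + t • (x (i+1) - x i) + v) ≤ ∫⁻ z in Ω ∩ ball p D, G z := by
    intro i hi
    rw [lintegral_lintegral_swap (hm i).aemeasurable]
    have hb : ∀ t ∈ Icc (0:ℝ) 1, ∫⁻ v in ball (0:E) ρ, G (x i + t • (x (i+1) - x i) + v) ≤
        ∫⁻ z in Ω ∩ ball p D, G z := by
      intro t ht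
      set y := x i + t • (x (i+1) - x i) with hy
      have hmp : MeasurePreserving (fun v : E => y + v) volume volume :=
        measurePreserving_add_left volume y
      have e : ball (0:E) ρ = (fun v : E => y + v) ⁻¹' ball y ρ := by
        ext v; simp
      rw [e, hmp.setLIntegral_comp_preimage measurableSet_ball hGm]
      exact lintegral_mono_set (hseg i (Finset.mem_range.1 hi) t ht)
    refine (setLIntegral_mono' measurableSet_Icc hb).trans ?_
    simp
  refine (Finset.sum_le_sum this).trans ?_
  simp

lemma packing (Λ s : ℝ) (hΛ : 0 ≤ Λ) (hs : 0 < s) (x : E) (T : Finset E)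
    (hsep : ∀ p ∈ T, ∀ q ∈ T, p ≠ q → s ≤ dist p q) (hT : ∀ p ∈ T, dist x p < Λ * s) :
    (T.card : ℝ) ≤ (2 * Λ + 2) ^ Module.finrank ℝ E := by
  have hd : (T : Set E).PairwiseDisjoint (fun p => ball p (s / 2)) := by
    intro p hp q hq hpq
    exact ball_disjoint_ball (by linarith [hsep p hp q hq hpq])
  have h1 : ∑ p ∈ T, volume (ball p (s / 2)) ≤ volume (ball x ((2 * Λ + 2) * (s / 2))) := by
    rw [← measure_biUnion_finset hd (fun _ _ => measurableSet_ball)]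
    apply measure_mono
    intro z hz
    simp only [mem_iUnion, mem_ball] at hz ⊢
    obtain ⟨p, hp, hz⟩ := hz
    have := hT p hp
    have := dist_triangle z p x
    rw [dist_comm p x] at this
    nlinarith
  rw [Measure.addHaar_ball_mul_of_pos _ _ (by linarith)] at h1
  simp_rw [Measure.addHaar_ball_center volume _ (s / 2)] at h1
  rw [Finset.sum_const, nsmul_eq_mul, ENNReal.mul_le_mul_iff_left
    (measure_ball_pos _ _ (by linarith)).ne' measure_ball_lt_top.ne] at h1
  rw [← ENNReal.ofReal_natCast] at h1
  exact (ENNReal.ofReal_le_ofReal_iff (by positivity)).1 h1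

lemma exists_net (s : ℝ) (hs : 0 < s) (D : Set E) (hD : Bornology.IsBounded D) :
    ∃ T : Finset E, (∀ p ∈ T, p ∈ D) ∧ (∀ p ∈ T, ∀ q ∈ T, p ≠ q → s ≤ dist p q) ∧
      ∀ x ∈ D, ∃ p ∈ T, dist x p < s := by
  classical
  obtain ⟨R, hR⟩ := hD.subset_ball (0:E)
  set Λ := max R 0 / s with hΛ
  have hΛ0 : 0 ≤ Λ := by positivity
  have hΛs : Λ * s = max R 0 := by rw [hΛ]; field_simp
  let Q : ℕ → Prop := fun k => ∃ T : Finset E, T.card = k ∧ (∀ p ∈ T, p ∈ D) ∧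
    (∀ p ∈ T, ∀ q ∈ T, p ≠ q → s ≤ dist p q)
  have hbd : ∀ k, Q k → k ≤ ⌊(2 * Λ + 2) ^ Module.finrank ℝ E⌋₊ := by
    rintro k ⟨T, rfl, h1, h2⟩
    apply Nat.le_floor
    refine packing Λ s hΛ0 hs 0 T h2 fun p hp => ?_
    rw [hΛs, dist_comm]
    exact (hR (h1 p hp)).trans_le (le_max_left _ _)
  have hQ0 : Q 0 := ⟨∅, by simp⟩
  obtain ⟨T, hc, h1, h2⟩ := Nat.findGreatest_spec (P := Q) (Nat.zero_le _) hQ0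
  refine ⟨T, h1, h2, fun x hx => ?_⟩
  by_contra! hcon
  have hxT : x ∉ T := fun h => by
    have := hcon x h
    simp at this; linarith
  have hQ1 : Q (T.card + 1) := by
    refine ⟨insert x T, by simp [hxT], ?_, ?_⟩
    · intro p hp
      rcases Finset.mem_insert.1 hp with rfl | h
      exacts [hx, h1 _ h]
    · intro p hp q hq hpq
      rcases Finset.mem_insert.1 hp with rfl | h <;> rcases Finset.mem_insert.1 hq with rfl | h'
      · exact absurd rfl hpq
      · exact hcon _ h'
      · rw [dist_comm]; exact hcon _ h
      · exact h2 _ h _ h' hpq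
  have := Nat.le_findGreatest (hbd _ hQ1) hQ1
  rw [← hc] at this
  omega

end A
end RobinCacc

namespace RobinCacc

section B
set_option linter.unusedSectionVars false
variable {E : Type*} [NormedAddCommGroup E] [InnerProductSpace ℝ E] [FiniteDimensional ℝ E]
  [MeasurableSpace E] [BorelSpace E]

lemma pou (f : ContDiffBump (0:E)) (B : ℝ) (hB : ∀ x, ‖fderiv ℝ f x‖ ≤ B) (s : ℝ) (hs : 0 < s)
    (P : Finset E) (c : E → ℝ) :
    ∃ φ : E → ℝ, ContDiff ℝ 1 φ ∧ ∀ x, (∃ p ∈ P, dist x p ≤ f.rIn * s) →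
      (∀ m e : ℝ, (∀ p ∈ P, dist x p < f.rOut * s → |c p - m| ≤ e) → |φ x - m| ≤ e) ∧
      ‖fderiv ℝ φ x‖ ≤ B / s * ∑ p ∈ P with dist x p < f.rOut * s,
        ∑ q ∈ P with dist x q < f.rOut * s, |c p - c q| := by
  classical
  set ψ : E → E → ℝ := fun p x => f (s⁻¹ • (x - p)) with hψ
  have hψc : ∀ p, ContDiff ℝ 1 (ψ p) := by
    intro p
    have : ContDiff ℝ 1 (f : E → ℝ) := f.contDiff
    exact this.comp (by fun_prop)
  have hψ0 : ∀ p x, 0 ≤ ψ p x := fun p x => f.nonneg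
  have hψ1 : ∀ p x, ψ p x ≤ 1 := fun p x => f.le_one
  have hnorm : ∀ p x : E, ‖s⁻¹ • (x - p)‖ = s⁻¹ * dist x p := by
    intro p x
    rw [norm_smul, Real.norm_of_nonneg (by positivity), dist_eq_norm]
  have hψz : ∀ p x, ¬ dist x p < f.rOut * s → ψ p x = 0 := by
    intro p x h
    apply f.zero_of_le_dist
    rw [dist_zero_right, hnorm]
    rw [not_lt] at h
    rw [inv_mul_eq_div, le_div_iff₀ hs]; exact h
  have hψone : ∀ p x, dist x p ≤ f.rIn * s → ψ p x = 1 := by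
    intro p x h
    apply f.one_of_mem_closedBall
    rw [mem_closedBall, dist_zero_right, hnorm, inv_mul_eq_div, div_le_iff₀ hs]
    exact h
  have hDz : ∀ p x, ¬ dist x p < f.rOut * s → fderiv ℝ (ψ p) x = 0 := by
    intro p x h
    apply IsLocalMin.fderiv_eq_zero
    refine Filter.Eventually.of_forall fun y => ?_
    simp only [hψz p x h]; exact hψ0 p y
  have hB0 : 0 ≤ B := (norm_nonneg _).trans (hB 0)
  have hDB : ∀ p x, ‖fderiv ℝ (ψ p) x‖ ≤ B / s := by
    intro p x
    have h1 : HasFDerivAt (fun x : E => s⁻¹ • (x - p)) (s⁻¹ • ContinuousLinearMap.id ℝ E) x :=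
      ((hasFDerivAt_id x).sub_const p).const_smul s⁻¹
    have h2 : HasFDerivAt (f : E → ℝ) (fderiv ℝ f (s⁻¹ • (x - p))) (s⁻¹ • (x - p)) :=
      ((f.contDiff (n := 1)).differentiable one_ne_zero _).hasFDerivAt
    have h3 := (h2.comp x h1).fderiv
    have h4 : fderiv ℝ (ψ p) x = s⁻¹ • fderiv ℝ f (s⁻¹ • (x - p)) := by
      rw [hψ]
      refine Eq.trans h3 ?_
      ext z; simp
    rw [h4, norm_smul, Real.norm_of_nonneg (by positivity), inv_mul_eq_div]
    gcongr
    exact hB _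
  set Ψ : E → ℝ := fun x => ∑ p ∈ P, ψ p x with hΨ
  set Nn : E → ℝ := fun x => ∑ p ∈ P, c p * ψ p x with hNn
  have hΨc : ContDiff ℝ 1 Ψ := ContDiff.sum fun p _ => hψc p
  have hNc : ContDiff ℝ 1 Nn := ContDiff.sum fun p _ => contDiff_const.mul (hψc p)
  have hST : ContDiff ℝ 1 Real.smoothTransition := Real.smoothTransition.contDiff
  set φ : E → ℝ := fun x => Real.smoothTransition (4 * Ψ x - 1) * (Nn x / Ψ x) with hφ
  have hφc : ContDiff ℝ 1 φ := by
    rw [contDiff_iff_contDiffAt]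
    intro x
    by_cases hx : Ψ x < 1 / 4
    · have : φ =ᶠ[𝓝 x] fun _ => 0 := by
        filter_upwards [hΨc.continuous.continuousAt.eventually_lt continuousAt_const hx] with y hy
        simp only [hφ]
        rw [Real.smoothTransition.zero_of_nonpos (by linarith), zero_mul]
      exact contDiffAt_const.congr_of_eventuallyEq this
    · have h0 : Ψ x ≠ 0 := by linarith
      refine ContDiffAt.mul ?_ (hNc.contDiffAt.div hΨc.contDiffAt h0)
      exact (hST.comp ((contDiff_const.mul hΨc).sub contDiff_const)).contDiffAt
  refine ⟨φ, hφc, fun x hx => ?_⟩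
  obtain ⟨p₀, hp₀, hd₀⟩ := hx
  have hΨ1 : 1 ≤ Ψ x := by
    rw [← hψone p₀ x hd₀]
    exact Finset.single_le_sum (f := fun p => ψ p x) (fun p _ => hψ0 p x) hp₀
  have hev : ∀ᶠ y in 𝓝 x, φ y * Ψ y = Nn y := by
    filter_upwards [continuousAt_const.eventually_lt hΨc.continuous.continuousAt
      (show (1/2 : ℝ) < Ψ x by linarith)] with y hy
    simp only [hφ]
    rw [Real.smoothTransition.one_of_one_le (by linarith), one_mul, div_mul_cancel₀ _ (by linarith)]
  have hx0 := hev.self_of_nhds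
  have hmain : ∀ m, (φ x - m) * Ψ x = ∑ p ∈ P with dist x p < f.rOut * s, (c p - m) * ψ p x := by
    intro m
    rw [sub_mul, hx0, Finset.sum_filter_of_ne]
    · simp only [hNn, hΨ, Finset.mul_sum, ← Finset.sum_sub_distrib, sub_mul]
    · intro p hp h
      by_contra hc
      exact h (by rw [hψz p x hc, mul_zero])
  have hΨf : Ψ x = ∑ p ∈ P with dist x p < f.rOut * s, ψ p x := by
    rw [Finset.sum_filter_of_ne]
    intro p hp h
    by_contra hc
    exact h (hψz p x hc)
  constructor
  · intro m e he
    have h1 : |φ x - m| * Ψ x ≤ e * Ψ x := by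
      rw [← abs_of_pos (by linarith : 0 < Ψ x), ← abs_mul, abs_of_pos (by linarith : 0 < Ψ x), hmain]
      refine (Finset.abs_sum_le_sum_abs _ _).trans ?_
      rw [hΨf, Finset.mul_sum]
      refine Finset.sum_le_sum fun p hp => ?_
      rw [Finset.mem_filter] at hp
      rw [abs_mul, abs_of_nonneg (hψ0 p x)]
      exact mul_le_mul_of_nonneg_right (he p hp.1 hp.2) (hψ0 p x)
    exact le_of_mul_le_mul_right h1 (by linarith)
  · have hdist : ∀ m, |φ x - m| ≤ ∑ q ∈ P with dist x q < f.rOut * s, |c q - m| := by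
      intro m
      have h1 : |φ x - m| * 1 ≤ |φ x - m| * Ψ x := mul_le_mul_of_nonneg_left hΨ1 (abs_nonneg _)
      rw [mul_one] at h1
      refine h1.trans ?_
      rw [← abs_of_pos (by linarith : 0 < Ψ x), ← abs_mul, hmain]
      refine (Finset.abs_sum_le_sum_abs _ _).trans ?_
      refine Finset.sum_le_sum fun p hp => ?_
      rw [abs_mul, abs_of_nonneg (hψ0 p x)]
      exact mul_le_of_le_one_right (abs_nonneg _) (hψ1 p x)
    have hdφ : DifferentiableAt ℝ φ x := hφc.differentiable one_ne_zero x
    have hdΨ : DifferentiableAt ℝ Ψ x := hΨc.differentiable one_ne_zero x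
    have hdψ : ∀ p, DifferentiableAt ℝ (ψ p) x := fun p => (hψc p).differentiable one_ne_zero x
    have hD : φ x • fderiv ℝ Ψ x + Ψ x • fderiv ℝ φ x = fderiv ℝ Nn x := by
      rw [← fderiv_fun_mul hdφ hdΨ]
      exact Filter.EventuallyEq.fderiv_eq hev
    have hDΨ : fderiv ℝ Ψ x = ∑ p ∈ P, fderiv ℝ (ψ p) x := by
      rw [hΨ]; exact fderiv_fun_sum fun p _ => hdψ p
    have hDN : fderiv ℝ Nn x = ∑ p ∈ P, c p • fderiv ℝ (ψ p) x := by
      rw [hNn]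
      rw [fderiv_fun_sum fun p _ => (hdψ p).const_mul (c p)]
      exact Finset.sum_congr rfl fun p _ => fderiv_const_mul (hdψ p) (c p)
    have hD2 : Ψ x • fderiv ℝ φ x =
        ∑ p ∈ P with dist x p < f.rOut * s, (c p - φ x) • fderiv ℝ (ψ p) x := by
      rw [Finset.sum_filter_of_ne]
      · simp only [sub_smul, Finset.sum_sub_distrib, ← Finset.smul_sum]
        rw [← hDN, ← hDΨ, ← hD]; abel
      · intro p hp h
        by_contra hc
        exact h (by rw [hDz p x hc, smul_zero])
    have h1 : ‖fderiv ℝ φ x‖ ≤ ‖Ψ x • fderiv ℝ φ x‖ := by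
      rw [norm_smul, Real.norm_of_nonneg (by linarith)]
      exact le_mul_of_one_le_left (norm_nonneg _) hΨ1
    refine h1.trans ?_
    rw [hD2, Finset.mul_sum]
    refine (norm_sum_le _ _).trans (Finset.sum_le_sum fun p hp => ?_)
    rw [norm_smul, mul_comm]
    refine mul_le_mul (hDB p x) ?_ (norm_nonneg _) (by positivity)
    rw [Real.norm_eq_abs, abs_sub_comm]
    refine (hdist (c p)).trans (Finset.sum_le_sum fun q _ => ?_)
    rw [abs_sub_comm]

lemma pou_energy (f : ContDiffBump (0:E)) (B : ℝ) (hB : ∀ x, ‖fderiv ℝ f x‖ ≤ B) (s : ℝ) (hs : 0 < s)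
    (P : Finset E) (hsep : ∀ p ∈ P, ∀ q ∈ P, p ≠ q → s ≤ dist p q) (Ω : Set E) (hΩ : MeasurableSet Ω)
    (hcov : ∀ x ∈ closure Ω, ∃ p ∈ P, dist x p ≤ f.rIn * s) (c : E → ℝ) :
    ∃ φ : E → ℝ, ContDiff ℝ 1 φ ∧ (∀ x ∈ closure Ω,
      (∀ m e : ℝ, (∀ p ∈ P, dist x p < f.rOut * s → |c p - m| ≤ e) → |φ x - m| ≤ e)) ∧
      ∫⁻ x in Ω, ENNReal.ofReal (‖fderiv ℝ φ x‖ ^ 2) ≤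
        ENNReal.ofReal ((B / s) ^ 2 * ((2 * f.rOut + 2) ^ Module.finrank ℝ E) ^ 2) *
          (volume (ball (0:E) (f.rOut * s)) *
          ∑ p ∈ P, ∑ q ∈ P with dist p q < 2 * f.rOut * s, ENNReal.ofReal ((c q - c p) ^ 2)) := by
  classical
  obtain ⟨φ, h1, h2⟩ := pou f B hB s hs P c
  have hr := f.rOut_pos
  refine ⟨φ, h1, fun x hx => (h2 x (hcov x hx)).1, ?_⟩
  set K := (2 * f.rOut + 2) ^ Module.finrank ℝ E with hK
  have hpt : ∀ x ∈ Ω, ENNReal.ofReal (‖fderiv ℝ φ x‖ ^ 2) ≤ ENNReal.ofReal ((B / s) ^ 2 * K ^ 2) *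
      ∑ p ∈ P, ∑ q ∈ P with dist p q < 2 * f.rOut * s,
        (ball p (f.rOut * s)).indicator (fun _ => ENNReal.ofReal ((c q - c p) ^ 2)) x := by
    intro x hx
    have h3 := (h2 x (hcov x (subset_closure hx))).2
    set S := P.filter (fun p => dist x p < f.rOut * s) with hS
    have hcard : (S.card : ℝ) ≤ K := packing f.rOut s hr.le hs x S
      (fun p hp q hq => hsep p (Finset.mem_filter.1 hp).1 q (Finset.mem_filter.1 hq).1)
      (fun p hp => (Finset.mem_filter.1 hp).2)
    have h4 : (∑ p ∈ S, ∑ q ∈ S, |c p - c q|) ^ 2 ≤ K ^ 2 * ∑ p ∈ S, ∑ q ∈ S, (c q - c p) ^ 2 := by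
      rw [← Finset.sum_product', ← Finset.sum_product']
      refine sq_sum_le_card_mul_sum_sq.trans ?_
      rw [Finset.card_product]
      push_cast
      have : ∀ z : E × E, |c z.1 - c z.2| ^ 2 = (c z.2 - c z.1) ^ 2 := fun z => by
        rw [sq_abs]; ring
      simp_rw [this]
      refine mul_le_mul_of_nonneg_right ?_ (Finset.sum_nonneg fun _ _ => sq_nonneg _)
      rw [sq]
      exact mul_le_mul hcard hcard (by positivity) (by positivity)
    have h5 : ‖fderiv ℝ φ x‖ ^ 2 ≤ (B / s) ^ 2 * K ^ 2 * ∑ p ∈ S, ∑ q ∈ S, (c q - c p) ^ 2 := by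
      refine (pow_le_pow_left₀ (norm_nonneg _) h3 2).trans ?_
      rw [mul_pow, mul_assoc]
      exact mul_le_mul_of_nonneg_left h4 (by positivity)
    refine (ENNReal.ofReal_le_ofReal h5).trans ?_
    rw [ENNReal.ofReal_mul (by positivity)]
    refine mul_le_mul_right ?_ _
    rw [ENNReal.ofReal_sum_of_nonneg (fun _ _ => Finset.sum_nonneg fun _ _ => sq_nonneg _)]
    refine (Finset.sum_le_sum fun p hp => ?_).trans (Finset.sum_le_sum_of_subset (Finset.filter_subset _ _))
    rw [ENNReal.ofReal_sum_of_nonneg (fun _ _ => sq_nonneg _)]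
    have hxp := (Finset.mem_filter.1 hp).2
    have hsub : S ⊆ P.filter (fun q => dist p q < 2 * f.rOut * s) := by
      intro q hq
      rw [Finset.mem_filter] at hq ⊢
      refine ⟨hq.1, ?_⟩
      have := dist_triangle_left p q x
      linarith [hq.2]
    refine le_trans ?_ (Finset.sum_le_sum_of_subset hsub)
    refine Finset.sum_le_sum fun q hq => ?_
    rw [indicator_of_mem (by simpa using hxp)]
  refine (setLIntegral_mono' hΩ hpt).trans ?_
  refine (setLIntegral_le_lintegral _ _).trans ?_
  rw [lintegral_const_mul' _ _ ENNReal.ofReal_ne_top]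
  refine mul_le_mul_right ?_ _
  have hmeas : ∀ p q, Measurable ((ball p (f.rOut * s)).indicator
      (fun _ : E => ENNReal.ofReal ((c q - c p) ^ 2))) := fun p q =>
    measurable_const.indicator measurableSet_ball
  rw [lintegral_finsetSum _ (fun p _ => Finset.measurable_fun_sum _ fun q _ => hmeas p q), Finset.mul_sum]
  refine Finset.sum_le_sum fun p _ => ?_
  rw [lintegral_finsetSum _ (fun q _ => hmeas p q), Finset.mul_sum]
  refine Finset.sum_le_sum fun q _ => ?_
  rw [lintegral_indicator_const measurableSet_ball, Measure.addHaar_ball_center, mul_comm]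

end B
end RobinCacc

namespace RobinCacc

lemma ball_sub {n : ℕ} {Ω : Set (EuclideanSpace ℝ (Fin n))} (hΩ : IsOpen Ω)
    {x : EuclideanSpace ℝ (Fin n)} (hx : x ∈ Ω) : ball x (infDist x (frontier Ω)) ⊆ Ω := by
  rcases (ball x (infDist x (frontier Ω))).eq_empty_or_nonempty with he | hne
  · rw [he]; exact empty_subset _
  have hpos : 0 < infDist x (frontier Ω) := nonempty_ball.1 hne
  refine IsPreconnected.subset_left_of_subset_union hΩ (isClosed_closure (s := Ω)).isOpen_compl
    (disjoint_compl_right.mono_left subset_closure) ?_ ⟨x, mem_ball_self hpos, hx⟩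
    (convex_ball _ _).isPreconnected
  intro y hy
  by_contra hc
  simp only [mem_union, mem_compl_iff, not_or, not_not] at hc
  have hf : y ∈ frontier Ω := by
    rw [hΩ.frontier_eq]; exact ⟨hc.2, hc.1⟩
  have := infDist_le_dist_of_mem (x := x) hf
  rw [mem_ball, dist_comm] at hy
  linarith

lemma chain_geom {n : ℕ} {M : ℝ} {Ω : Set (EuclideanSpace ℝ (Fin n))} (h : IsOneSidedNTA M Ω) :
    ∃ N : ℕ, ∃ τ : ℝ, 0 < τ ∧ τ ≤ 1 ∧ ∃ Λ : ℝ, 0 < Λ ∧ ∀ s : ℝ, 0 < s → 20 * M * s < diam Ω / 10 →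
      ∀ p ∈ Ω, ∀ q ∈ Ω, s ≤ infDist p (frontier Ω) → s ≤ infDist q (frontier Ω) →
      dist p q < 16 * M * s → ∃ x : ℕ → EuclideanSpace ℝ (Fin n), x 0 = p ∧ x N = q ∧
        ∀ i < N, ‖x (i+1) - x i‖ ≤ Λ * s ∧ ∀ t ∈ Icc (0:ℝ) 1,
          ball (x i + t • (x (i+1) - x i)) (τ * s) ⊆ Ω ∩ ball p (Λ * s) := by
  have hM := h.M_gt_one
  obtain ⟨k₀, hk₀⟩ := pow_unbounded_of_one_lt (16 * M) (one_lt_two : (1:ℝ) < 2)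
  set k := k₀ + 1 with hk
  have hk16 : 16 * M ≤ 2 ^ k := by rw [hk, pow_succ]; nlinarith
  set N₀ := ⌈M * (k:ℝ)⌉₊ with hN₀
  have hN₀2 : 1 < N₀ := by
    rw [hN₀, Nat.lt_ceil]
    have : (1:ℝ) ≤ k := by rw [hk]; push_cast; linarith [(Nat.cast_nonneg k₀ : (0:ℝ) ≤ k₀)]
    push_cast; nlinarith
  obtain ⟨N, hN⟩ : ∃ N, N₀ = N + 1 := ⟨N₀ - 1, by omega⟩
  have hN1 : 1 ≤ N := by omega
  set τ : ℝ := (9/10) ^ N / 2 with hτ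
  have hτpos : 0 < τ := by positivity
  have hτ1 : τ ≤ 1 / 2 := by
    have : ((9:ℝ)/10) ^ N ≤ 1 := pow_le_one₀ (by norm_num) (by norm_num)
    rw [hτ]; linarith
  set Λ : ℝ := (11/10) ^ N * (32 * M) with hΛ
  have hpowN : (11/10:ℝ) ≤ (11/10) ^ N := by
    calc (11/10:ℝ) = (11/10) ^ 1 := by norm_num
      _ ≤ _ := pow_le_pow_right₀ (by norm_num) hN1
  have hΛ32 : 32 * M ≤ Λ := by rw [hΛ]; nlinarith
  refine ⟨N, τ, hτpos, by linarith, Λ, by linarith, ?_⟩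
  intro s hs hsd p hp q hq hδp hδq hpq
  have hτs : τ * s ≤ 1 / 2 * s := by gcongr
  have hMs : s < M * s := by nlinarith
  have hΛs : 32 * M * s ≤ Λ * s := by gcongr
  by_cases hA : 32 * M * s ≤ infDist p (frontier Ω) ∨ p = q
  · have hz : ∀ y z, dist y p ≤ dist p q → z ∈ ball y (τ * s) → z ∈ Ω ∩ ball p (Λ * s) := by
      intro y z hy hz
      rw [mem_ball] at hz
      have htri := dist_triangle z y p
      refine ⟨ball_sub h.isOpen hp ?_, ?_⟩
      · rw [mem_ball]
        rcases hA with hA | hA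
        · nlinarith
        · rw [hA, dist_self, ← hA] at hy
          nlinarith
      · rw [mem_ball]; nlinarith
    refine ⟨fun j => if j = 0 then p else q, by simp, by simp [show N ≠ 0 by omega], ?_⟩
    intro i hi
    by_cases hi0 : i = 0
    · subst hi0
      simp only [zero_add, one_ne_zero, if_false, if_true]
      refine ⟨?_, fun t ht z hzz => hz _ z ?_ hzz⟩
      · rw [← dist_eq_norm, dist_comm]; nlinarith
      · rw [dist_eq_norm, add_sub_cancel_left, norm_smul, Real.norm_of_nonneg ht.1, dist_comm p q,
          dist_eq_norm]
        exact mul_le_of_le_one_left (norm_nonneg _) ht.2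
    · simp only [hi0, if_false, Nat.succ_ne_zero, sub_self, norm_zero, smul_zero, add_zero]
      refine ⟨by nlinarith, fun t ht z hzz => hz _ z ?_ hzz⟩
      rw [dist_comm]
  · push Not at hA
    obtain ⟨hA, hne⟩ := hA
    obtain ⟨c, ρ, hc1, hcN, hc⟩ := h.harnack (dist p q) s k (dist_pos.2 hne) (by nlinarith) hs
      (by omega) p hp q hq rfl hδp hδq (by nlinarith)
    rw [← hN₀] at hcN hc
    have hstep : ∀ j < N, dist (c (j+2)) (c (j+1)) ≤ infDist (c (j+1)) (frontier Ω) / 10 := by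
      intro j hj
      obtain ⟨_, h2, _, h4⟩ := hc (j+1) (by omega) (by omega)
      have := h4 (by omega)
      rw [mem_ball] at this
      linarith
    have hin : ∀ j ≤ N, c (j+1) ∈ Ω := by
      intro j hj
      obtain ⟨h1, _, h3, _⟩ := hc (j+1) (by omega) (by omega)
      exact h3 (mem_ball_self h1)
    have hind : ∀ j ≤ N, (9/10) ^ j * s ≤ infDist (c (j+1)) (frontier Ω) ∧
        infDist (c (j+1)) (frontier Ω) ≤ (11/10) ^ j * (32 * M * s) ∧
        dist (c (j+1)) p ≤ ((11/10) ^ j - 1) * (32 * M * s) := by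
      intro j
      induction j with
      | zero => intro _; simp [hc1]; exact ⟨hδp, hA.le⟩
      | succ j ih =>
        intro hj
        obtain ⟨i1, i2, i3⟩ := ih (by omega)
        have hs1 := hstep j (by omega)
        have l1 := infDist_le_infDist_add_dist (s := frontier Ω) (x := c (j+1)) (y := c (j+2))
        have l2 := infDist_le_infDist_add_dist (s := frontier Ω) (x := c (j+2)) (y := c (j+1))
        rw [dist_comm] at l1
        have l3 := dist_triangle (c (j+2)) (c (j+1)) p
        simp only [pow_succ, add_assoc]
        norm_num
        refine ⟨by linarith, by linarith, by linarith⟩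
    refine ⟨fun j => c (j+1), hc1, by rw [hN] at hcN; exact hcN, ?_⟩
    intro i hi
    obtain ⟨i1, i2, i3⟩ := hind i hi.le
    have hs1 := hstep i hi
    have e9 : τ * s ≤ infDist (c (i+1)) (frontier Ω) / 2 := by
      have : ((9:ℝ)/10) ^ N ≤ (9/10) ^ i := pow_le_pow_of_le_one (by norm_num) (by norm_num) hi.le
      rw [hτ]; nlinarith
    have e11 : (11/10:ℝ) ^ i * (11/10) * (32 * M * s) ≤ Λ * s := by
      have : (11/10:ℝ) ^ (i+1) ≤ (11/10) ^ N := pow_le_pow_right₀ (by norm_num) hi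
      rw [pow_succ] at this
      rw [hΛ]
      have h0 : 0 ≤ 32 * M * s := by nlinarith
      calc _ = (11/10:ℝ) ^ i * (11/10) * (32 * M * s) := by ring
        _ ≤ (11/10) ^ N * (32 * M * s) := by gcongr
        _ = _ := by ring
    have hpos11 : (1:ℝ) ≤ (11/10) ^ i := one_le_pow₀ (by norm_num)
    have hMs0 : 0 < 32 * M * s := by nlinarith
    refine ⟨?_, ?_⟩
    · rw [← dist_eq_norm]
      have : 0 ≤ (11/10:ℝ) ^ i * (32 * M * s) := by positivity
      show dist (c (i+2)) (c (i+1)) ≤ _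
      linarith
    · intro t ht z hz
      have hy : dist (c (i+1) + t • (c (i+2) - c (i+1))) (c (i+1)) ≤
          infDist (c (i+1)) (frontier Ω) / 10 := by
        rw [dist_eq_norm, add_sub_cancel_left, norm_smul, Real.norm_of_nonneg ht.1]
        rw [dist_eq_norm] at hs1
        exact (mul_le_of_le_one_left (norm_nonneg _) ht.2).trans hs1
      have hz' : dist z (c (i+1) + t • (c (i+2) - c (i+1))) < τ * s := hz
      have t1 := dist_triangle z (c (i+1) + t • (c (i+2) - c (i+1))) (c (i+1))
      have t2 := dist_triangle z (c (i+1)) p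
      have hδ0 : 0 < infDist (c (i+1)) (frontier Ω) := lt_of_lt_of_le (by positivity) i1
      refine ⟨ball_sub h.isOpen (hin i hi.le) ?_, ?_⟩
      · rw [mem_ball]; linarith
      · rw [mem_ball]; linarith

lemma corks {n : ℕ} {M : ℝ} {Ω : Set (EuclideanSpace ℝ (Fin n))} (h : IsOneSidedNTA M Ω)
    (hb : Bornology.IsBounded Ω) (hne : (frontier Ω).Nonempty) (s : ℝ) (hs : 0 < s)
    (hsd : 20 * M * s < diam Ω / 10) (x : EuclideanSpace ℝ (Fin n)) (hx : x ∈ closure Ω) :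
    ∃ z ∈ Ω, s ≤ infDist z (frontier Ω) ∧ dist x z < (M + 2) * s := by
  have hM := h.M_gt_one
  obtain ⟨y, hy, hxy⟩ := Metric.mem_closure_iff.1 hx s hs
  by_cases hd : s ≤ infDist y (frontier Ω)
  · exact ⟨y, hy, hd, by nlinarith⟩
  · push Not at hd
    have hcpt : IsCompact (frontier Ω) :=
      Metric.isCompact_of_isClosed_isBounded isClosed_frontier
        (hb.closure.subset frontier_subset_closure)
    obtain ⟨Q, hQ, hQd⟩ := hcpt.exists_infDist_eq_dist hne y
    obtain ⟨A, ⟨hA, hAb⟩, hAd⟩ := h.corkscrew Q hQ (M * s) (by nlinarith) (by nlinarith)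
    rw [mul_div_cancel_left₀ _ (by linarith)] at hAd
    refine ⟨A, hA, hAd, ?_⟩
    rw [mem_ball, dist_comm] at hAb
    have := dist_triangle4 x y Q A
    nlinarith

end RobinCacc

namespace RobinCacc

lemma overlap {n : ℕ} (Ω : Set (EuclideanSpace ℝ (Fin n)))
    (G : EuclideanSpace ℝ (Fin n) → ℝ≥0∞) (hG : Measurable G) (Λ s : ℝ) (hΛ : 0 ≤ Λ) (hs : 0 < s)
    (P : Finset (EuclideanSpace ℝ (Fin n)))
    (hsep : ∀ p ∈ P, ∀ q ∈ P, p ≠ q → s ≤ dist p q) :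
    ∑ p ∈ P, ∫⁻ z in Ω ∩ ball p (Λ * s), G z ≤
      ENNReal.ofReal ((2 * Λ + 2) ^ Module.finrank ℝ (EuclideanSpace ℝ (Fin n))) *
        ∫⁻ z in Ω, G z := by
  classical
  have e : ∀ p, ∫⁻ z in Ω ∩ ball p (Λ * s), G z =
      ∫⁻ z in Ω, (ball p (Λ * s)).indicator G z := by
    intro p
    rw [lintegral_indicator measurableSet_ball, Measure.restrict_restrict measurableSet_ball,
      inter_comm]
  simp_rw [e]
  rw [← lintegral_finsetSum _ (fun p _ => hG.indicator measurableSet_ball),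
    ← lintegral_const_mul' _ _ ENNReal.ofReal_ne_top]
  refine lintegral_mono fun z => ?_
  have : ∀ p, (ball p (Λ * s)).indicator G z = if dist z p < Λ * s then G z else 0 := by
    intro p; simp [indicator_apply]
  simp_rw [this]
  rw [← Finset.sum_filter, Finset.sum_const, nsmul_eq_mul]
  refine mul_le_mul_left ?_ _
  rw [← ENNReal.ofReal_natCast]
  apply ENNReal.ofReal_le_ofReal
  exact packing Λ s hΛ hs z _
    (fun p hp q hq => hsep p (Finset.mem_filter.1 hp).1 q (Finset.mem_filter.1 hq).1)
    (fun p hp => (Finset.mem_filter.1 hp).2)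

lemma core {n : ℕ} {M : ℝ} {Ω : Set (EuclideanSpace ℝ (Fin n))} (h : IsOneSidedNTA M Ω)
    (hb : Bornology.IsBounded Ω) (hne : (frontier Ω).Nonempty) (hdiam : 0 < diam Ω)
    (w : EuclideanSpace ℝ (Fin n) → ℝ) (hwc : ContinuousOn w (closure Ω))
    (hw : ∀ x ∈ Ω, ContDiffAt ℝ 1 w x)
    (hL : ∫⁻ z in Ω, ENNReal.ofReal (‖fderiv ℝ w z‖ ^ 2) ≠ ⊤) :
    ∃ K : ℝ≥0∞, K ≠ ⊤ ∧ ∀ ε : ℝ, 0 < ε → ∃ φ : EuclideanSpace ℝ (Fin n) → ℝ, ContDiff ℝ 1 φ ∧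
      (∀ x ∈ closure Ω, |φ x - w x| ≤ ε) ∧
      ∫⁻ z in Ω, ENNReal.ofReal (‖fderiv ℝ φ z‖ ^ 2) ≤ K := by
  classical
  have hM := h.M_gt_one
  obtain ⟨N, τ, hτ, hτ1, Λ, hΛ, hchain⟩ := chain_geom h
  let f : ContDiffBump (0 : EuclideanSpace ℝ (Fin n)) :=
    ⟨4 * M, 8 * M, by linarith, by linarith⟩
  have hfIn : f.rIn = 4 * M := rfl
  have hfOut : f.rOut = 8 * M := rfl
  obtain ⟨B, hB⟩ : ∃ B, ∀ x, ‖fderiv ℝ f x‖ ≤ B :=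
    (f.hasCompactSupport.fderiv ℝ).exists_bound_of_continuous
      ((f.contDiff (n := 1)).continuous_fderiv one_ne_zero)
  set dm := Module.finrank ℝ (EuclideanSpace ℝ (Fin n)) with hdm
  set G : EuclideanSpace ℝ (Fin n) → ℝ≥0∞ := fun z => ENNReal.ofReal (‖fderiv ℝ w z‖ ^ 2) with hG
  have hGm : Measurable G := measurable_energy w
  set I := ∫⁻ z in Ω, G z with hI
  set K1 : ℝ≥0∞ := ENNReal.ofReal ((2 * (16 * M) + 2) ^ dm) with hK1
  set K2 : ℝ≥0∞ := ENNReal.ofReal ((2 * Λ + 2) ^ dm) with hK2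
  set K3 : ℝ≥0∞ := ENNReal.ofReal ((8 * M / τ) ^ dm) with hK3
  set K4 : ℝ := (2 * (8 * M) + 2) ^ dm with hK4
  refine ⟨ENNReal.ofReal (B ^ 2 * K4 ^ 2 * (N * Λ ^ 2)) * (K3 * (N * K1 * (K2 * I))), ?_, ?_⟩
  · refine ENNReal.mul_ne_top ENNReal.ofReal_ne_top (ENNReal.mul_ne_top ENNReal.ofReal_ne_top
      (ENNReal.mul_ne_top (ENNReal.mul_ne_top (ENNReal.natCast_ne_top _) ENNReal.ofReal_ne_top)
      (ENNReal.mul_ne_top ENNReal.ofReal_ne_top hL)))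
  intro ε hε
  have hcpt : IsCompact (closure Ω) :=
    Metric.isCompact_of_isClosed_isBounded isClosed_closure hb.closure
  obtain ⟨η, hη, huc⟩ := Metric.uniformContinuousOn_iff_le.1
    (hcpt.uniformContinuousOn_of_continuous hwc) ε hε
  obtain ⟨s, hs, hsd, hsη⟩ : ∃ s : ℝ, 0 < s ∧ 20 * M * s < diam Ω / 10 ∧ (8 * M + 1) * s ≤ η := by
    refine ⟨min (diam Ω / 10 / (20 * M) / 2) (η / (8 * M + 1)), ?_, ?_, ?_⟩
    · refine lt_min ?_ ?_ <;> positivity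
    · refine lt_of_le_of_lt (mul_le_mul_of_nonneg_left (min_le_left _ _) (by linarith)) ?_
      field_simp
      norm_num
    · refine (mul_le_mul_of_nonneg_left (min_le_right _ _) (by linarith)).trans ?_
      rw [mul_div_cancel₀ _ (by linarith)]
  obtain ⟨P, hPD, hsep, hnet⟩ := exists_net s hs {z | z ∈ Ω ∧ s ≤ infDist z (frontier Ω)}
    (hb.subset fun z hz => hz.1)
  have hcov : ∀ x ∈ closure Ω, ∃ p ∈ P, dist x p ≤ f.rIn * s := by
    intro x hx
    obtain ⟨z, hz, hzd, hxz⟩ := corks h hb hne s hs hsd x hx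
    obtain ⟨p, hp, hzp⟩ := hnet z ⟨hz, hzd⟩
    refine ⟨p, hp, ?_⟩
    rw [hfIn]
    have := dist_triangle x z p
    nlinarith
  have hpv : ∀ p ∈ P, ∀ v ∈ ball (0 : EuclideanSpace ℝ (Fin n)) (τ * s), p + v ∈ Ω := by
    intro p hp v hv
    refine ball_sub h.isOpen (hPD p hp).1 ?_
    rw [mem_ball_zero_iff] at hv
    rw [mem_ball, dist_eq_norm, add_sub_cancel_left]
    have := (hPD p hp).2
    nlinarith
  set F : EuclideanSpace ℝ (Fin n) → ℝ≥0∞ := fun v =>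
    ∑ p ∈ P, ∑ q ∈ P with dist p q < 2 * f.rOut * s, ENNReal.ofReal ((w (q + v) - w (p + v)) ^ 2) with hF
  have hcont1 : ∀ p ∈ P, ContinuousOn (fun v => w (p + v))
      (ball (0 : EuclideanSpace ℝ (Fin n)) (τ * s)) := by
    intro p hp
    refine hwc.comp (by fun_prop) fun v hv => subset_closure (hpv p hp v hv)
  have hmeas1 : ∀ p ∈ P, ∀ q ∈ P, AEMeasurable (fun v => ENNReal.ofReal ((w (q + v) - w (p + v)) ^ 2))
      (volume.restrict (ball (0 : EuclideanSpace ℝ (Fin n)) (τ * s))) := by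
    intro p hp q hq
    refine AEMeasurable.ennreal_ofReal ?_
    exact (((hcont1 q hq).sub (hcont1 p hp)).pow 2).aemeasurable measurableSet_ball
  have hmeas2 : ∀ p ∈ P, AEMeasurable (fun v => ∑ q ∈ P with dist p q < 2 * f.rOut * s,
      ENNReal.ofReal ((w (q + v) - w (p + v)) ^ 2))
      (volume.restrict (ball (0 : EuclideanSpace ℝ (Fin n)) (τ * s))) := fun p hp =>
    Finset.aemeasurable_fun_sum _ fun q hq => hmeas1 p hp q (Finset.mem_filter.1 hq).1
  have hFm : AEMeasurable F (volume.restrict (ball (0 : EuclideanSpace ℝ (Fin n)) (τ * s))) :=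
    Finset.aemeasurable_fun_sum _ fun p hp => hmeas2 p hp
  set V := volume (ball (0 : EuclideanSpace ℝ (Fin n)) (τ * s)) with hV
  have hV0 : V ≠ 0 := (measure_ball_pos _ _ (by positivity)).ne'
  have hVt : V ≠ ⊤ := measure_ball_lt_top.ne
  have hFint : ∫⁻ v in ball (0 : EuclideanSpace ℝ (Fin n)) (τ * s), F v ≤
      ENNReal.ofReal (N * (Λ * s) ^ 2) * (N * K1 * (K2 * I)) := by
    rw [hF, lintegral_finsetSum' _ hmeas2]
    have hp1 : ∀ p ∈ P, ∫⁻ v in ball (0 : EuclideanSpace ℝ (Fin n)) (τ * s),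
        ∑ q ∈ P with dist p q < 2 * f.rOut * s, ENNReal.ofReal ((w (q + v) - w (p + v)) ^ 2) ≤
        ENNReal.ofReal (N * (Λ * s) ^ 2) * (N * K1) * ∫⁻ z in Ω ∩ ball p (Λ * s), G z := by
      intro p hp
      rw [lintegral_finsetSum' _ fun q hq => hmeas1 p hp q (Finset.mem_filter.1 hq).1]
      have hq1 : ∀ q ∈ P.filter (fun q => dist p q < 2 * f.rOut * s),
          ∫⁻ v in ball (0 : EuclideanSpace ℝ (Fin n)) (τ * s),
            ENNReal.ofReal ((w (q + v) - w (p + v)) ^ 2) ≤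
          ENNReal.ofReal (N * (Λ * s) ^ 2) * (N * ∫⁻ z in Ω ∩ ball p (Λ * s), G z) := by
        intro q hq
        obtain ⟨hqP, hpq⟩ := Finset.mem_filter.1 hq
        obtain ⟨x, hx0, hxN, hx⟩ := hchain s hs hsd p (hPD p hp).1 q (hPD q hqP).1 (hPD p hp).2
          (hPD q hqP).2 (by rw [hfOut] at hpq; linarith)
        exact pair_est h.isOpen hw x N (Λ * s) (τ * s) (Λ * s) p q hx0 hxN
          (fun i hi => (hx i hi).1) (fun i hi => (hx i hi).2)
      refine (Finset.sum_le_sum hq1).trans ?_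
      rw [Finset.sum_const, nsmul_eq_mul]
      have hcard : ((P.filter (fun q => dist p q < 2 * f.rOut * s)).card : ℝ≥0∞) ≤ K1 := by
        rw [← ENNReal.ofReal_natCast]
        apply ENNReal.ofReal_le_ofReal
        exact packing (16 * M) s (by linarith) hs p _
          (fun p hp q hq => hsep p (Finset.mem_filter.1 hp).1 q (Finset.mem_filter.1 hq).1)
          (fun q hq => by
            have := (Finset.mem_filter.1 hq).2
            rw [hfOut] at this; linarith)
      refine (mul_le_mul_left hcard _).trans (le_of_eq ?_)
      ring
    refine (Finset.sum_le_sum hp1).trans ?_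
    rw [← Finset.mul_sum, mul_assoc]
    refine mul_le_mul_right (mul_le_mul_right ?_ _) _
    exact overlap Ω G hGm Λ s hΛ.le hs P hsep
  obtain ⟨v, hv, hFv⟩ := exists_le_setLAverage hV0 hVt hFm
  rw [setLAverage_eq, ← hV] at hFv
  obtain ⟨φ, hφ, hφc, hφe⟩ := pou_energy f B hB s hs P hsep Ω h.isOpen.measurableSet hcov
    (fun p => w (p + v))
  refine ⟨φ, hφ, fun x hx => ?_, hφe.trans ?_⟩
  · refine hφc x hx (w x) ε fun p hp hxp => ?_
    rw [← Real.dist_eq]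
    refine huc _ (subset_closure (hpv p hp v hv)) _ hx ?_
    rw [mem_ball_zero_iff] at hv
    have h1 : dist (p + v) p = ‖v‖ := by rw [dist_eq_norm, add_sub_cancel_left]
    have h2 := dist_triangle (p + v) p x
    rw [dist_comm p x] at h2
    rw [hfOut] at hxp
    nlinarith
  · have hvol : volume (ball (0 : EuclideanSpace ℝ (Fin n)) (f.rOut * s)) = K3 * V := by
      rw [hK3, hV, ← Measure.addHaar_ball_mul_of_pos _ (0 : EuclideanSpace ℝ (Fin n))
        (by positivity : 0 < 8 * M / τ), hfOut]
      congr 2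
      field_simp
    have hVF : V * F v ≤ ENNReal.ofReal (N * (Λ * s) ^ 2) * (N * K1 * (K2 * I)) := by
      refine le_trans ?_ hFint
      refine (mul_le_mul_right hFv _).trans (le_of_eq ?_)
      exact ENNReal.mul_div_cancel hV0 hVt
    rw [hvol, mul_assoc]
    refine (mul_le_mul_right (mul_le_mul_right hVF _) _).trans (le_of_eq ?_)
    rw [hfOut, ← hdm, ← hK4]
    rw [mul_left_comm K3, ← mul_assoc, ← ENNReal.ofReal_mul (by positivity)]
    congr 2
    field_simp

end RobinCacc

namespace RobinCacc

lemma mollify {n : ℕ} (φ : EuclideanSpace ℝ (Fin n) → ℝ) (hφ : ContDiff ℝ 1 φ)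
    (hc : HasCompactSupport φ) (Y : EuclideanSpace ℝ (Fin n)) (ρ ε : ℝ) (hρ : 0 < ρ) (hε : 0 < ε)
    (h0 : ∀ x ∈ ball Y ρ, φ x = 0) :
    ∃ φ' : EuclideanSpace ℝ (Fin n) → ℝ, ContDiff ℝ (⊤ : ℕ∞) φ' ∧ HasCompactSupport φ' ∧
      (∀ x ∈ ball Y (ρ / 2), φ' x = 0) ∧ (∀ x, |φ' x - φ x| ≤ ε) ∧
      ∀ x, ‖fderiv ℝ φ' x - fderiv ℝ φ x‖ ≤ ε := by
  have hD : Continuous (fderiv ℝ φ) := hφ.continuous_fderiv (by norm_num)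
  have u1 : UniformContinuous φ := hc.uniformContinuous_of_continuous hφ.continuous
  have u2 : UniformContinuous (fderiv ℝ φ) :=
    (hc.fderiv ℝ).uniformContinuous_of_continuous hD
  obtain ⟨d1, hd1, H1⟩ := Metric.uniformContinuous_iff.1 u1 ε hε
  obtain ⟨d2, hd2, H2⟩ := Metric.uniformContinuous_iff.1 u2 ε hε
  set d := min (min d1 d2) (ρ / 2) with hd
  have hdp : 0 < d := by simp only [hd]; positivity
  let b : ContDiffBump (0 : EuclideanSpace ℝ (Fin n)) := ⟨d / 2, d, by positivity, by linarith⟩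
  have hbc : HasCompactSupport (b.normed volume) := b.hasCompactSupport_normed
  have hbs : ContDiff ℝ (⊤ : ℕ∞) (b.normed volume) := b.contDiff_normed
  let φ' := (MeasureTheory.convolution (b.normed volume) φ (ContinuousLinearMap.lsmul ℝ ℝ) volume)
  refine ⟨φ', ?_, ?_, ?_, ?_, ?_⟩
  · exact hbc.contDiff_convolution_left _ hbs hφ.continuous.locallyIntegrable
  · exact hbc.convolution _ hc
  · intro x hx
    have : φ' x = φ x := by
      apply b.normed_convolution_eq_right
      intro y hy
      have hxx : x ∈ ball Y ρ := ball_subset_ball (by linarith) hx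
      rw [h0 x hxx, h0 y]
      simp only [mem_ball] at *
      have h4 : d ≤ ρ / 2 := min_le_right _ _
      have h5 : dist y x < d := hy
      linarith [dist_triangle y x Y]
    rw [this, h0 x (ball_subset_ball (by linarith) hx)]
  · intro x
    have := b.dist_normed_convolution_le (μ := volume) (g := φ) (x₀ := x) (ε := ε)
      hφ.continuous.aestronglyMeasurable (fun y hy => (H1 (lt_of_lt_of_le (mem_ball.1 hy)
        ((min_le_left _ _).trans (min_le_left _ _)))).le)
    rwa [Real.dist_eq] at this
  · intro x
    have e := hc.hasFDerivAt_convolution_right (ContinuousLinearMap.lsmul ℝ ℝ) (μ := volume)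
      (f := b.normed volume) b.continuous_normed.locallyIntegrable hφ x
    have e2 : fderiv ℝ φ' x = MeasureTheory.convolution (b.normed volume) (fderiv ℝ φ)
        (ContinuousLinearMap.lsmul ℝ ℝ) volume x := by
      rw [e.fderiv]
      rfl
    rw [e2, ← dist_eq_norm]
    exact b.dist_normed_convolution_le (μ := volume) (g := fderiv ℝ φ) (x₀ := x) (ε := ε)
      hD.aestronglyMeasurable (fun y hy => (H2 (lt_of_lt_of_le (mem_ball.1 hy)
        ((min_le_left _ _).trans (min_le_right _ _)))).le)

end RobinCacc

namespace RobinCacc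

/-- The bilinear form of the Robin problem, tested on `φ`. -/
noncomputable def wform {n : ℕ} (Ω : Set (EuclideanSpace ℝ (Fin n)))
    (σ : Measure (EuclideanSpace ℝ (Fin n))) (a : ℝ)
    (u φ : EuclideanSpace ℝ (Fin n) → ℝ) : ℝ :=
  (∫ x in Ω, fderiv ℝ φ x (gradient u x)) + a * ∫ p in frontier Ω, u p * φ p ∂σ

lemma meas_gradient {n : ℕ} (u : EuclideanSpace ℝ (Fin n) → ℝ) : Measurable (gradient u) := by
  have : gradient u = fun x => (InnerProductSpace.toDual ℝ (EuclideanSpace ℝ (Fin n))).symm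
      (fderiv ℝ u x) := rfl
  rw [this]
  exact (LinearIsometryEquiv.continuous _).measurable.comp (measurable_fderiv ℝ u)

lemma norm_gradient {n : ℕ} (u : EuclideanSpace ℝ (Fin n) → ℝ) (x) :
    ‖gradient u x‖ = ‖fderiv ℝ u x‖ := by
  have : gradient u x = (InnerProductSpace.toDual ℝ (EuclideanSpace ℝ (Fin n))).symm
      (fderiv ℝ u x) := rfl
  rw [this, LinearIsometryEquiv.norm_map]

lemma fderiv_gradient {n : ℕ} (u φ : EuclideanSpace ℝ (Fin n) → ℝ) (x) :
    fderiv ℝ φ x (gradient u x) = ⟪gradient u x, gradient φ x⟫ := by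
  rw [real_inner_comm, ← InnerProductSpace.toDual_apply_apply, toDual_gradient]

lemma meas_pair {n : ℕ} (u φ : EuclideanSpace ℝ (Fin n) → ℝ) :
    Measurable (fun x => fderiv ℝ φ x (gradient u x)) := by
  simp_rw [fderiv_gradient]
  exact (meas_gradient u).inner (meas_gradient φ)

lemma fderiv_zero_ball {n : ℕ} {φ : EuclideanSpace ℝ (Fin n) → ℝ} {Y : EuclideanSpace ℝ (Fin n)}
    {ρ : ℝ} (h0 : ∀ x ∈ ball Y ρ, φ x = 0) : ∀ x ∈ ball Y ρ, fderiv ℝ φ x = 0 := by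
  intro x hx
  have : φ =ᶠ[𝓝 x] fun _ => (0 : ℝ) := by
    filter_upwards [isOpen_ball.mem_nhds hx] with y hy using h0 y hy
  rw [this.fderiv_eq]; simp

lemma int_outer {n : ℕ} {Ω : Set (EuclideanSpace ℝ (Fin n))} {u : EuclideanSpace ℝ (Fin n) → ℝ}
    {Y : EuclideanSpace ℝ (Fin n)} {ρ : ℝ}
    (hu2 : IntegrableOn (fun x => ‖gradient u x‖ ^ 2) (Ω \ ball Y ρ) volume) :
    IntegrableOn ((ball Y ρ)ᶜ.indicator (fun x => ‖gradient u x‖ ^ 2)) Ω volume := by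
  rw [IntegrableOn, integrable_indicator_iff measurableSet_ball.compl, IntegrableOn,
    Measure.restrict_restrict measurableSet_ball.compl, inter_comm]
  exact hu2

lemma abs_pair_le {n : ℕ} (L : EuclideanSpace ℝ (Fin n) →L[ℝ] ℝ) (v : EuclideanSpace ℝ (Fin n)) :
    |L v| ≤ ‖L‖ ^ 2 + ‖v‖ ^ 2 := by
  have h := L.le_opNorm v
  rw [Real.norm_eq_abs] at h
  nlinarith [sq_nonneg (‖L‖ - ‖v‖), sq_nonneg ‖L‖, sq_nonneg ‖v‖]

lemma int_pair {n : ℕ} {Ω : Set (EuclideanSpace ℝ (Fin n))} (hΩ : IsOpen Ω)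
    {u : EuclideanSpace ℝ (Fin n) → ℝ}
    {Y : EuclideanSpace ℝ (Fin n)} {ρ : ℝ}
    (hu2 : IntegrableOn (fun x => ‖gradient u x‖ ^ 2) (Ω \ ball Y ρ) volume)
    {φ : EuclideanSpace ℝ (Fin n) → ℝ} (h0 : ∀ x ∈ ball Y ρ, φ x = 0)
    (hφ : IntegrableOn (fun x => ‖fderiv ℝ φ x‖ ^ 2) Ω volume) :
    IntegrableOn (fun x => fderiv ℝ φ x (gradient u x)) Ω volume := by
  refine Integrable.mono' (hφ.add (int_outer hu2)) (meas_pair u φ).aestronglyMeasurable ?_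
  refine Filter.Eventually.of_forall fun x => ?_
  rw [Real.norm_eq_abs]
  by_cases hx : x ∈ ball Y ρ
  · rw [fderiv_zero_ball h0 x hx]
    simp [indicator_apply, hx]
  · simp only [Pi.add_apply]
    rw [indicator_of_mem (by simpa using hx)]
    exact abs_pair_le _ _

lemma cont_int {n : ℕ} {σ : Measure (EuclideanSpace ℝ (Fin n))}
    {K : Set (EuclideanSpace ℝ (Fin n))} (hK : IsCompact K) (hσ : σ K ≠ ⊤)
    {f : EuclideanSpace ℝ (Fin n) → ℝ} (hf : ContinuousOn f K) : IntegrableOn f K σ := by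
  obtain ⟨C, hC⟩ := hK.exists_bound_of_continuousOn hf
  haveI : IsFiniteMeasure (σ.restrict K) := ⟨by simpa using hσ.lt_top⟩
  refine Integrable.mono' (integrable_const C) (hf.aestronglyMeasurable hK.measurableSet) ?_
  filter_upwards [ae_restrict_mem hK.measurableSet] with x hx using hC x hx

lemma cmpI {n : ℕ} {Ω : Set (EuclideanSpace ℝ (Fin n))} (hΩ : IsOpen Ω)
    (hb : Bornology.IsBounded Ω)
    {σ : Measure (EuclideanSpace ℝ (Fin n))} (hσ : σ (frontier Ω) ≠ ⊤) {a : ℝ} (ha : 0 < a)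
    {u : EuclideanSpace ℝ (Fin n) → ℝ} (huc : ContinuousOn u (frontier Ω))
    {Y : EuclideanSpace ℝ (Fin n)} {ρ : ℝ}
    (hu2 : IntegrableOn (fun x => ‖gradient u x‖ ^ 2) (Ω \ ball Y ρ) volume)
    {φ ψ : EuclideanSpace ℝ (Fin n) → ℝ}
    (hφ0 : ∀ x ∈ ball Y ρ, φ x = 0) (hψ0 : ∀ x ∈ ball Y ρ, ψ x = 0)
    (hφ : IntegrableOn (fun x => ‖fderiv ℝ φ x‖ ^ 2) Ω volume)
    (hψ : IntegrableOn (fun x => ‖fderiv ℝ ψ x‖ ^ 2) Ω volume)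
    (hφc : ContinuousOn φ (frontier Ω)) (hψc : ContinuousOn ψ (frontier Ω))
    {b : EuclideanSpace ℝ (Fin n) → ℝ} (hbi : IntegrableOn b Ω volume) {e : ℝ}
    (hb1 : ∀ x ∈ Ω, |fderiv ℝ φ x (gradient u x) - fderiv ℝ ψ x (gradient u x)| ≤ b x)
    (he : ∀ x ∈ frontier Ω, |φ x - ψ x| ≤ e) :
    |wform Ω σ a u φ - wform Ω σ a u ψ| ≤ (∫ x in Ω, b x) +
      a * (e * ∫ p in frontier Ω, |u p| ∂σ) := by
  have hK : IsCompact (frontier Ω) :=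
    Metric.isCompact_of_isClosed_isBounded isClosed_frontier
      (hb.closure.subset frontier_subset_closure)
  have i1 := int_pair hΩ hu2 hφ0 hφ
  have i2 := int_pair hΩ hu2 hψ0 hψ
  have j1 : IntegrableOn (fun p => u p * φ p) (frontier Ω) σ := cont_int hK hσ (huc.mul hφc)
  have j2 : IntegrableOn (fun p => u p * ψ p) (frontier Ω) σ := cont_int hK hσ (huc.mul hψc)
  have j3 := cont_int hK hσ huc.abs
  have e1 : wform Ω σ a u φ - wform Ω σ a u ψ =
      (∫ x in Ω, (fderiv ℝ φ x (gradient u x) - fderiv ℝ ψ x (gradient u x))) +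
        a * ∫ p in frontier Ω, (u p * φ p - u p * ψ p) ∂σ := by
    rw [integral_sub i1 i2, integral_sub j1 j2, wform, wform]; ring
  rw [e1]
  refine (abs_add_le _ _).trans (add_le_add ?_ ?_)
  · refine (abs_integral_le_integral_abs).trans ?_
    exact setIntegral_mono_on (i1.sub i2).abs hbi hΩ.measurableSet hb1
  · rw [abs_mul, abs_of_pos ha]
    refine mul_le_mul_of_nonneg_left ?_ ha.le
    refine (abs_integral_le_integral_abs).trans ?_
    rw [← integral_const_mul]
    refine setIntegral_mono_on (j1.sub j2).abs (j3.const_mul e) hK.measurableSet ?_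
    intro x hx
    rw [← mul_sub, abs_mul, mul_comm]
    exact mul_le_mul_of_nonneg_right (he x hx) (abs_nonneg _)

lemma energy_C1 {n : ℕ} {Ω : Set (EuclideanSpace ℝ (Fin n))}
    (hb : Bornology.IsBounded Ω) {φ : EuclideanSpace ℝ (Fin n) → ℝ} (hφ : ContDiff ℝ 1 φ) :
    IntegrableOn (fun x => ‖fderiv ℝ φ x‖ ^ 2) Ω volume := by
  have hK : IsCompact (closure Ω) :=
    Metric.isCompact_of_isClosed_isBounded isClosed_closure hb.closure
  exact (cont_int hK hK.measure_lt_top.ne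
    ((hφ.continuous_fderiv (by norm_num)).norm.pow 2).continuousOn).mono_set subset_closure

lemma weakC1 {n : ℕ} {Ω : Set (EuclideanSpace ℝ (Fin n))} (hΩ : IsOpen Ω)
    (hb : Bornology.IsBounded Ω)
    {σ : Measure (EuclideanSpace ℝ (Fin n))} (hσ : σ (frontier Ω) ≠ ⊤) {a : ℝ} (ha : 0 < a)
    {u : EuclideanSpace ℝ (Fin n) → ℝ} (huc : ContinuousOn u (frontier Ω))
    {Y : EuclideanSpace ℝ (Fin n)} {ρ : ℝ} (hρ : 0 < ρ)
    (hu2 : ∀ ρ : ℝ, 0 < ρ → IntegrableOn (fun x => ‖gradient u x‖ ^ 2) (Ω \ ball Y ρ) volume)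
    (hweak : ∀ φ : EuclideanSpace ℝ (Fin n) → ℝ,
      ContDiff ℝ (⊤ : ℕ∞) φ → HasCompactSupport φ → Y ∉ tsupport φ →
      (∫ X in Ω, ⟪gradient u X, gradient φ X⟫) + a * ∫ P in frontier Ω, u P * φ P ∂σ = 0)
    {φ : EuclideanSpace ℝ (Fin n) → ℝ} (hφ : ContDiff ℝ 1 φ) (hc : HasCompactSupport φ)
    (h0 : ∀ x ∈ ball Y ρ, φ x = 0) : wform Ω σ a u φ = 0 := by
  set G : EuclideanSpace ℝ (Fin n) → ℝ :=
    (ball Y (ρ / 2))ᶜ.indicator (fun x => ‖gradient u x‖ ^ 2) with hG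
  have iG : IntegrableOn G Ω volume := int_outer (hu2 _ (by linarith))
  have ione : IntegrableOn (fun _ : EuclideanSpace ℝ (Fin n) => (1 : ℝ)) Ω volume :=
    integrableOn_const hb.measure_lt_top.ne
  have G0 : ∀ x, 0 ≤ G x := fun x => indicator_nonneg (fun _ _ => by positivity) x
  set C : ℝ := (∫ x in Ω, (1 + G x)) + a * ∫ p in frontier Ω, |u p| ∂σ with hC
  have C0 : 0 ≤ C := by
    have h1 : 0 ≤ ∫ x in Ω, (1 + G x) := integral_nonneg fun x => by
      have := G0 x; simp only [Pi.zero_apply]; linarith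
    have h2 : 0 ≤ ∫ p in frontier Ω, |u p| ∂σ := integral_nonneg fun x => abs_nonneg _
    positivity
  have key : ∀ ε : ℝ, 0 < ε → |wform Ω σ a u φ| ≤ ε * C := by
    intro ε hε
    obtain ⟨φ', h1, h2, h3, h4, h5⟩ := mollify φ hφ hc Y ρ ε hρ hε h0
    have hz : wform Ω σ a u φ' = 0 := by
      have := hweak φ' h1 h2 (by
        rw [notMem_tsupport_iff_eventuallyEq]
        filter_upwards [ball_mem_nhds Y (half_pos hρ)] with y hy using h3 y hy)
      rw [wform]; simp_rw [fderiv_gradient]; exact this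
    have h0' : ∀ x ∈ ball Y (ρ / 2), φ x = 0 := fun x hx =>
      h0 x (ball_subset_ball (by linarith) hx)
    have h1' : ContDiff ℝ 1 φ' := h1.of_le (by exact_mod_cast le_top)
    have := cmpI hΩ hb hσ ha huc (hu2 _ (half_pos hρ)) h0' h3 (energy_C1 hb hφ) (energy_C1 hb h1')
      hφ.continuous.continuousOn h1.continuous.continuousOn (b := fun x => ε * (1 + G x))
      ((ione.add iG).const_mul ε) (e := ε) (by
        intro x hx
        rw [← sub_apply]
        by_cases hxb : x ∈ ball Y (ρ / 2)
        · rw [fderiv_zero_ball h0' x hxb, fderiv_zero_ball h3 x hxb]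
          have := G0 x
          simp only [sub_self, zero_apply, abs_zero]; positivity
        · have hGx : G x = ‖gradient u x‖ ^ 2 := indicator_of_mem (by simpa using hxb) _
          rw [hGx]
          have q1 := (fderiv ℝ φ x - fderiv ℝ φ' x).le_opNorm (gradient u x)
          rw [Real.norm_eq_abs] at q1
          have q2 := h5 x
          rw [norm_sub_rev] at q2
          refine q1.trans (mul_le_mul q2 ?_ (norm_nonneg _) hε.le)
          nlinarith [sq_nonneg (‖gradient u x‖ - 1)])
      (by intro x _; rw [abs_sub_comm]; exact h4 x)
    rw [hz, sub_zero, integral_const_mul] at this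
    refine this.trans (le_of_eq ?_)
    rw [hC]; ring
  by_contra hne
  have hp : 0 < |wform Ω σ a u φ| := abs_pos.2 hne
  have := key (|wform Ω σ a u φ| / (2 * (C + 1))) (by positivity)
  have h6 : |wform Ω σ a u φ| / (2 * (C + 1)) * C < |wform Ω σ a u φ| := by
    rw [div_mul_eq_mul_div, div_lt_iff₀ (by positivity)]
    nlinarith
  linarith

end RobinCacc

namespace RobinCacc

lemma weakC1' {n : ℕ} {Ω : Set (EuclideanSpace ℝ (Fin n))} (hΩ : IsOpen Ω)
    (hb : Bornology.IsBounded Ω)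
    {σ : Measure (EuclideanSpace ℝ (Fin n))} (hσ : σ (frontier Ω) ≠ ⊤) {a : ℝ} (ha : 0 < a)
    {u : EuclideanSpace ℝ (Fin n) → ℝ} (huc : ContinuousOn u (frontier Ω))
    {Y : EuclideanSpace ℝ (Fin n)} {ρ : ℝ} (hρ : 0 < ρ)
    (hu2 : ∀ ρ : ℝ, 0 < ρ → IntegrableOn (fun x => ‖gradient u x‖ ^ 2) (Ω \ ball Y ρ) volume)
    (hweak : ∀ φ : EuclideanSpace ℝ (Fin n) → ℝ,
      ContDiff ℝ (⊤ : ℕ∞) φ → HasCompactSupport φ → Y ∉ tsupport φ →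
      (∫ X in Ω, ⟪gradient u X, gradient φ X⟫) + a * ∫ P in frontier Ω, u P * φ P ∂σ = 0)
    {φ : EuclideanSpace ℝ (Fin n) → ℝ} (hφ : ContDiff ℝ 1 φ)
    (h0 : ∀ x ∈ ball Y ρ, φ x = 0) : wform Ω σ a u φ = 0 := by
  obtain ⟨R, hR, hsub⟩ := hb.closure.subset_ball_lt 0 (0 : EuclideanSpace ℝ (Fin n))
  let b : ContDiffBump (0 : EuclideanSpace ℝ (Fin n)) := ⟨R, R + 1, hR, by linarith⟩
  have hone : ∀ x ∈ ball (0 : EuclideanSpace ℝ (Fin n)) R, b x * φ x = φ x := by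
    intro x hx
    rw [b.one_of_mem_closedBall (ball_subset_closedBall hx), one_mul]
  have := weakC1 hΩ hb hσ ha huc hρ hu2 hweak (φ := fun x => b x * φ x)
    (b.contDiff.mul hφ) (b.hasCompactSupport.mul_right) (fun x hx => by simp [h0 x hx])
  rw [← this, wform, wform]
  congr 1
  · refine setIntegral_congr_fun hΩ.measurableSet fun x hx => ?_
    have e : (fun x => b x * φ x) =ᶠ[𝓝 x] φ := by
      filter_upwards [isOpen_ball.mem_nhds (hsub (subset_closure hx))] with y hy using hone y hy
    simp only [e.fderiv_eq]
  · congr 1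
    refine setIntegral_congr_fun isClosed_frontier.measurableSet fun x hx => ?_
    simp only [hone x (hsub (frontier_subset_closure hx))]

lemma fd_glue {n : ℕ} {w φ χ : EuclideanSpace ℝ (Fin n) → ℝ} {x : EuclideanSpace ℝ (Fin n)}
    (hw : DifferentiableAt ℝ w x) (hφ : DifferentiableAt ℝ φ x) (hχ : DifferentiableAt ℝ χ x) :
    fderiv ℝ w x - fderiv ℝ (fun x => χ x * w x + (1 - χ x) * φ x) x =
      (1 - χ x) • (fderiv ℝ w x - fderiv ℝ φ x) - (w x - φ x) • fderiv ℝ χ x := by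
  rw [fderiv_fun_add (hχ.fun_mul hw) (((differentiableAt_const 1).fun_sub hχ).fun_mul hφ),
    fderiv_fun_mul hχ hw, fderiv_fun_mul ((differentiableAt_const 1).fun_sub hχ) hφ,
    fderiv_const_sub]
  module

set_option maxHeartbeats 1600000 in
lemma weakW {n : ℕ} {M : ℝ} {Ω : Set (EuclideanSpace ℝ (Fin n))} (h : IsOneSidedNTA M Ω)
    (hb : Bornology.IsBounded Ω) (hne : (frontier Ω).Nonempty) (hdiam : 0 < diam Ω)
    {σ : Measure (EuclideanSpace ℝ (Fin n))} (hσ : σ (frontier Ω) ≠ ⊤) {a : ℝ} (ha : 0 < a)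
    {u : EuclideanSpace ℝ (Fin n) → ℝ} (huc : ContinuousOn u (frontier Ω))
    {Y : EuclideanSpace ℝ (Fin n)} (hY : Y ∈ Ω) {r : ℝ} (hr : 0 < r)
    (hu2 : ∀ ρ : ℝ, 0 < ρ → IntegrableOn (fun x => ‖gradient u x‖ ^ 2) (Ω \ ball Y ρ) volume)
    (hweak : ∀ φ : EuclideanSpace ℝ (Fin n) → ℝ,
      ContDiff ℝ (⊤ : ℕ∞) φ → HasCompactSupport φ → Y ∉ tsupport φ →
      (∫ X in Ω, ⟪gradient u X, gradient φ X⟫) + a * ∫ P in frontier Ω, u P * φ P ∂σ = 0)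
    {w : EuclideanSpace ℝ (Fin n) → ℝ} (hwc : ContinuousOn w (closure Ω))
    (hw : ∀ x ∈ Ω, ContDiffAt ℝ 1 w x)
    (hw0 : ∀ x ∈ ball Y r, w x = 0)
    (hw2 : IntegrableOn (fun x => ‖fderiv ℝ w x‖ ^ 2) Ω volume) :
    wform Ω σ a u w = 0 := by
  have hΩ := h.isOpen
  have hcne : (Ωᶜ).Nonempty := by
    obtain ⟨p, hp⟩ := hne
    exact ⟨p, fun hp' => by
      rw [hΩ.frontier_eq] at hp; exact hp.2 hp'⟩
  obtain ⟨ρ0, hρ0, hρsub⟩ := Metric.nhds_basis_closedBall.mem_iff.1 (hΩ.mem_nhds hY)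
  set ρ := min ρ0 r with hρd
  have hρ : 0 < ρ := lt_min hρ0 hr
  set G : EuclideanSpace ℝ (Fin n) → ℝ :=
    (ball Y ρ)ᶜ.indicator (fun x => ‖gradient u x‖ ^ 2) with hG
  have iG : IntegrableOn G Ω volume := int_outer (hu2 _ hρ)
  have ione : IntegrableOn (fun _ : EuclideanSpace ℝ (Fin n) => (1 : ℝ)) Ω volume :=
    integrableOn_const hb.measure_lt_top.ne
  have G0 : ∀ x, 0 ≤ G x := fun x => indicator_nonneg (fun _ _ => by positivity) x
  have hGo : ∀ x, x ∉ ball Y ρ → G x = ‖gradient u x‖ ^ 2 := fun x hx =>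
    indicator_of_mem (by simpa using hx) _
  clear_value G
  have hL : ∫⁻ z in Ω, ENNReal.ofReal (‖fderiv ℝ w z‖ ^ 2) ≠ ⊤ := by
    rw [← ofReal_integral_eq_lintegral_ofReal hw2
      (Filter.Eventually.of_forall fun x => by simp only [Pi.zero_apply]; positivity)]
    exact ENNReal.ofReal_ne_top
  obtain ⟨K, hK, hcore⟩ := core h hb hne hdiam w hwc hw hL
  set W := ∫ x in Ω, ‖fderiv ℝ w x‖ ^ 2 with hW
  have W0 : 0 ≤ W := integral_nonneg fun x => by simp only [Pi.zero_apply]; positivity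
  have K0 : 0 ≤ K.toReal := ENNReal.toReal_nonneg
  set V : ℝ := (∫ x in Ω, (1 + G x)) + a * ∫ p in frontier Ω, |u p| ∂σ with hV
  have V1 : 0 ≤ ∫ x in Ω, (1 + G x) := integral_nonneg fun x => by
    have := G0 x; simp only [Pi.zero_apply]; linarith
  have V2 : 0 ≤ a * ∫ p in frontier Ω, |u p| ∂σ :=
    mul_nonneg ha.le (integral_nonneg fun x => abs_nonneg _)
  have V0 : 0 ≤ V := add_nonneg V1 V2
  have key : ∀ l : ℝ, 1 ≤ l → |wform Ω σ a u w| ≤ (2 + W + K.toReal) / l := by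
    intro l hl
    have hl0 : 0 < l := by linarith
    set s : ℕ → Set (EuclideanSpace ℝ (Fin n)) :=
      fun j => Ω ∩ {x | infDist x Ωᶜ < 1 / ((j : ℝ) + 1)} with hs
    have hsm : ∀ j, MeasurableSet (s j) := fun j =>
      (hΩ.inter (isOpen_lt (continuous_infDist_pt _) continuous_const)).measurableSet
    have hanti : Antitone s := by
      intro i j hij x hx
      refine ⟨hx.1, show infDist x Ωᶜ < 1 / ((i : ℝ) + 1) from
        lt_of_lt_of_le (show infDist x Ωᶜ < 1 / ((j : ℝ) + 1) from hx.2) ?_⟩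
      have : (i : ℝ) ≤ j := by exact_mod_cast hij
      exact one_div_le_one_div_of_le (by positivity) (by linarith)
    have hemp : ⋂ j, s j = ∅ := by
      rw [eq_empty_iff_forall_notMem]
      intro x hx
      rw [mem_iInter] at hx
      have hxΩ := (hx 0).1
      have hpos : 0 < infDist x Ωᶜ := by
        refine (hΩ.isClosed_compl.notMem_iff_infDist_pos hcne).1 ?_
        simpa using hxΩ
      obtain ⟨j, hj⟩ := exists_nat_one_div_lt hpos
      exact absurd (hx j).2 (not_lt.2 hj.le)
    have ht := tendsto_setIntegral_of_antitone (μ := volume) (f := G) hsm hanti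
      ⟨0, iG.mono_set inter_subset_left⟩
    rw [hemp, setIntegral_empty] at ht
    obtain ⟨j, hj⟩ := (ht.eventually (gt_mem_nhds (show (0 : ℝ) < 1 / l ^ 2 by positivity))).exists
    set T : Set (EuclideanSpace ℝ (Fin n)) :=
      {x | 1 / ((j : ℝ) + 1) ≤ infDist x Ωᶜ} ∪ closedBall Y ρ0 with hT
    have hTc : IsClosed T :=
      (isClosed_le continuous_const (continuous_infDist_pt _)).union isClosed_closedBall
    have hTd : Disjoint Ωᶜ T := by
      rw [Set.disjoint_left]
      rintro x hx (hx' | hx')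
      · simp only [mem_ofPred_eq] at hx'
        rw [infDist_zero_of_mem hx] at hx'
        have : (0 : ℝ) < 1 / ((j : ℝ) + 1) := by positivity
        linarith
      · exact hx (hρsub hx')
    obtain ⟨χ, hχ0, hχ1, hχI⟩ := exists_contMDiffMap_zero_one_nhds_of_isClosed
      (modelWithCornersSelf ℝ (EuclideanSpace ℝ (Fin n))) (n := 1) hΩ.isClosed_compl hTc hTd
    have hχs : ContDiff ℝ 1 χ := χ.contMDiff.contDiff
    have hcpt : IsCompact (closure Ω) :=
      Metric.isCompact_of_isClosed_isBounded isClosed_closure hb.closure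
    obtain ⟨c, hc⟩ := hcpt.exists_bound_of_continuousOn
      (hχs.continuous_fderiv (by norm_num)).continuousOn
    have hcpos : 0 ≤ c := (norm_nonneg _).trans (hc Y (subset_closure hY))
    set ε := 1 / (l * ((c + 1) * (V + 1))) with hε
    have hε0 : 0 < ε := by positivity
    obtain ⟨φ, hφ, hφw, hφe⟩ := hcore ε hε0
    have iφ := energy_C1 hb hφ
    have hφK : ∫ x in Ω, ‖fderiv ℝ φ x‖ ^ 2 ≤ K.toReal := by
      rw [← ofReal_integral_eq_lintegral_ofReal iφ
        (Filter.Eventually.of_forall fun x => by simp only [Pi.zero_apply]; positivity)] at hφe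
      exact (ENNReal.ofReal_le_iff_le_toReal hK).1 hφe
    set f : EuclideanSpace ℝ (Fin n) → ℝ := fun x => χ x * w x + (1 - χ x) * φ x with hf
    have hfs : ContDiff ℝ 1 f := by
      rw [contDiff_iff_contDiffAt]
      intro x
      by_cases hx : x ∈ Ω
      · exact (hχs.contDiffAt.mul (hw x hx)).add
          ((contDiffAt_const.sub hχs.contDiffAt).mul hφ.contDiffAt)
      · have e : f =ᶠ[𝓝 x] φ := by
          filter_upwards [Filter.Eventually.filter_mono (nhds_le_nhdsSet
            (show x ∈ Ωᶜ from hx)) hχ0] with y hy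
          simp [hf, hy]
        exact hφ.contDiffAt.congr_of_eventuallyEq e
    have hf0 : ∀ x ∈ ball Y ρ, f x = 0 := by
      intro x hx
      have h1 : χ x = 1 := hχ1.self_of_nhdsSet x
        (Or.inr (ball_subset_closedBall (ball_subset_ball (min_le_left _ _) hx)))
      simp [hf, h1, hw0 x (ball_subset_ball (min_le_right _ _) hx)]
    have hw0' : ∀ x ∈ ball Y ρ, w x = 0 := fun x hx =>
      hw0 x (ball_subset_ball (min_le_right _ _) hx)
    have hz := weakC1' hΩ hb hσ ha huc hρ hu2 hweak hfs hf0
    set b : EuclideanSpace ℝ (Fin n) → ℝ := fun x => l * (s j).indicator G x +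
      (1 / l) * (‖fderiv ℝ w x‖ ^ 2 + ‖fderiv ℝ φ x‖ ^ 2) + ε * c * (1 + G x) with hbd
    have iind : IntegrableOn ((s j).indicator G) Ω volume := iG.indicator (hsm j)
    have ib : IntegrableOn b Ω volume :=
      ((iind.const_mul l).add ((hw2.add iφ).const_mul (1 / l))).add
        ((ione.add iG).const_mul (ε * c))
    have hfd : ∀ x ∈ Ω, fderiv ℝ w x - fderiv ℝ f x =
        (1 - χ x) • (fderiv ℝ w x - fderiv ℝ φ x) - (w x - φ x) • fderiv ℝ χ x := by
      intro x hx
      exact fd_glue ((hw x hx).differentiableAt (by norm_num)) (hφ.differentiable (by norm_num) x)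
        (hχs.differentiable (by norm_num) x)
    have hbb : ∀ x ∈ Ω, |fderiv ℝ w x (gradient u x) - fderiv ℝ f x (gradient u x)| ≤ b x := by
      intro x hx
      have bnn : 0 ≤ b x := by
        have h1 : 0 ≤ (s j).indicator G x := indicator_nonneg (fun _ _ => G0 _) x
        have h2 := G0 x
        exact add_nonneg (add_nonneg (mul_nonneg hl0.le h1) (mul_nonneg (one_div_nonneg.2 hl0.le)
          (add_nonneg (sq_nonneg _) (sq_nonneg _))))
          (mul_nonneg (mul_nonneg hε0.le hcpos) (by linarith))
      rw [← sub_apply]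
      by_cases hxT : x ∈ T
      · have e : f =ᶠ[𝓝 x] w := by
          filter_upwards [Filter.Eventually.filter_mono (nhds_le_nhdsSet hxT) hχ1] with y hy
          simp [hf, hy]
        rw [e.fderiv_eq]; simpa using bnn
      · rw [hfd x hx]
        simp only [hT, mem_union, not_or, mem_ofPred_eq, not_le] at hxT
        have hxs : x ∈ s j := ⟨hx, hxT.1⟩
        have hxb : x ∉ ball Y ρ := fun hh =>
          hxT.2 (ball_subset_closedBall (ball_subset_ball (min_le_left _ _) hh))
        have hGx : G x = ‖gradient u x‖ ^ 2 := hGo x hxb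
        simp only [hbd, indicator_of_mem hxs, hGx]
        set v := gradient u x
        have o1 := (fderiv ℝ w x).le_opNorm v
        have o2 := (fderiv ℝ φ x).le_opNorm v
        have o3 := (fderiv ℝ χ x).le_opNorm v
        have o4 := hc x (subset_closure hx)
        have o5 : |w x - φ x| ≤ ε := by rw [abs_sub_comm]; exact hφw x (subset_closure hx)
        have o6 := hχI x
        rw [Real.norm_eq_abs] at o1 o2 o3
        simp only [sub_apply, smul_apply, smul_eq_mul]
        have p1 : |(1 - χ x) * (fderiv ℝ w x v - fderiv ℝ φ x v)| ≤
            (‖fderiv ℝ w x‖ + ‖fderiv ℝ φ x‖) * ‖v‖ := by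
          rw [abs_mul, abs_of_nonneg (by linarith [o6.2])]
          calc (1 - χ x) * |fderiv ℝ w x v - fderiv ℝ φ x v|
              ≤ 1 * |fderiv ℝ w x v - fderiv ℝ φ x v| :=
                mul_le_mul_of_nonneg_right (by linarith [o6.1]) (abs_nonneg _)
            _ ≤ _ := by
                have := abs_sub (fderiv ℝ w x v) (fderiv ℝ φ x v)
                linarith
        have p2 : |(w x - φ x) * fderiv ℝ χ x v| ≤ ε * c * (1 + ‖v‖ ^ 2) := by
          rw [abs_mul, mul_assoc]
          refine mul_le_mul o5 (o3.trans (mul_le_mul o4 ?_ (norm_nonneg _) hcpos))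
            (abs_nonneg _) hε0.le
          nlinarith [sq_nonneg (‖v‖ - 1)]
        have p3 : ∀ p : ℝ, p * ‖v‖ ≤ 1 / l * p ^ 2 + l * ‖v‖ ^ 2 / 2 := by
          intro p
          have : 1 / l * p ^ 2 + l * ‖v‖ ^ 2 / 2 - p * ‖v‖ =
              (1 / l) * ((p - l * ‖v‖ / 2) ^ 2 + l ^ 2 * ‖v‖ ^ 2 / 4) := by
            field_simp; ring
          have h2 : 0 ≤ (1 / l) * ((p - l * ‖v‖ / 2) ^ 2 + l ^ 2 * ‖v‖ ^ 2 / 4) := by positivity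
          linarith
        have p4 := p3 ‖fderiv ℝ w x‖
        have p5 := p3 ‖fderiv ℝ φ x‖
        refine (abs_sub _ _).trans ?_
        linarith
    have hfe : ∀ x ∈ frontier Ω, |w x - f x| ≤ ε := by
      intro x hx
      have o5 : |w x - φ x| ≤ ε := by
        rw [abs_sub_comm]; exact hφw x (frontier_subset_closure hx)
      have o6 := hχI x
      have : w x - f x = (1 - χ x) * (w x - φ x) := by simp only [hf]; ring
      rw [this, abs_mul, abs_of_nonneg (by linarith [o6.2])]
      nlinarith [abs_nonneg (w x - φ x), o6.1, o6.2]
    have hfin := cmpI hΩ hb hσ ha huc (hu2 _ hρ) hw0' hf0 hw2 (energy_C1 hb hfs)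
      (hwc.mono frontier_subset_closure) hfs.continuous.continuousOn ib hbb hfe
    rw [hz, sub_zero] at hfin
    have hint : ∫ x in Ω, b x = l * (∫ x in s j, G x) + (1 / l) * (W +
        ∫ x in Ω, ‖fderiv ℝ φ x‖ ^ 2) + ε * c * ∫ x in Ω, (1 + G x) := by
      have q1 : IntegrableOn (fun x => l * (s j).indicator G x) Ω volume := iind.const_mul l
      have q2 : IntegrableOn (fun x => (1 / l) * (‖fderiv ℝ w x‖ ^ 2 + ‖fderiv ℝ φ x‖ ^ 2))
        Ω volume := (hw2.add iφ).const_mul (1 / l)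
      have q3 : IntegrableOn (fun x => ε * c * (1 + G x)) Ω volume :=
        (ione.add iG).const_mul (ε * c)
      have q4 : IntegrableOn (fun x => l * (s j).indicator G x +
        (1 / l) * (‖fderiv ℝ w x‖ ^ 2 + ‖fderiv ℝ φ x‖ ^ 2)) Ω volume := q1.add q2
      simp only [hbd]
      rw [integral_add q4 q3, integral_add q1 q2, integral_const_mul, integral_const_mul,
        integral_const_mul, integral_add hw2 iφ, setIntegral_indicator (hsm j),
        inter_eq_self_of_subset_right (show s j ⊆ Ω from inter_subset_left)]
    rw [hint] at hfin
    have t1 : l * (∫ x in s j, G x) ≤ 1 / l := by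
      have := mul_le_mul_of_nonneg_left hj.le hl0.le
      refine this.trans (le_of_eq ?_)
      field_simp
    have t2 : (1 / l) * (W + ∫ x in Ω, ‖fderiv ℝ φ x‖ ^ 2) ≤ (1 / l) * (W + K.toReal) :=
      mul_le_mul_of_nonneg_left (by linarith) (by positivity)
    have t3 : ε * c * (∫ x in Ω, (1 + G x)) + a * (ε * ∫ p in frontier Ω, |u p| ∂σ) ≤ 1 / l := by
      have : ε * ((c + 1) * (V + 1)) = 1 / l := by
        rw [hε]; field_simp
      rw [← this]
      have e1 : ε * c * (∫ x in Ω, (1 + G x)) + a * (ε * ∫ p in frontier Ω, |u p| ∂σ) =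
        ε * (c * (∫ x in Ω, (1 + G x)) + a * ∫ p in frontier Ω, |u p| ∂σ) := by ring
      rw [e1]
      refine mul_le_mul_of_nonneg_left ?_ hε0.le
      have := mul_nonneg hcpos V2
      rw [hV]
      nlinarith
    have e3 : (2 + W + K.toReal) / l = 1 / l + (1 / l) * (W + K.toReal) + 1 / l := by
      field_simp; ring
    rw [e3]; linarith
  by_contra hcon
  have hp : 0 < |wform Ω σ a u w| := abs_pos.2 hcon
  set q := |wform Ω σ a u w| with hq
  have h1 := key (1 + (2 + W + K.toReal) / q) (by
    have : 0 ≤ (2 + W + K.toReal) / q := by positivity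
    linarith)
  rw [le_div_iff₀ (by positivity)] at h1
  have h2 : q * ((2 + W + K.toReal) / q) = 2 + W + K.toReal := by field_simp
  nlinarith

end RobinCacc

namespace RobinCacc

lemma cutoff (n : ℕ) : ∃ K : ℝ, 0 < K ∧ ∀ (Y : EuclideanSpace ℝ (Fin n)) (r : ℝ), 0 < r →
    ∃ η : EuclideanSpace ℝ (Fin n) → ℝ, ContDiff ℝ 1 η ∧ (∀ x, 0 ≤ η x) ∧ (∀ x, η x ≤ 1) ∧
      (∀ x ∈ ball Y r, η x = 0) ∧ (∀ x, x ∉ ball Y (2 * r) → η x = 1) ∧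
      (∀ x, ‖fderiv ℝ η x‖ ≤ K / r) ∧ (∀ x, x ∉ ball Y (2 * r) → fderiv ℝ η x = 0) := by
  let b : ContDiffBump (0 : EuclideanSpace ℝ (Fin n)) := ⟨1, 2, by norm_num, by norm_num⟩
  have hbs : ContDiff ℝ 1 b := b.contDiff
  obtain ⟨K, hK⟩ := (b.hasCompactSupport.fderiv ℝ).exists_bound_of_continuous
    (hbs.continuous_fderiv (by norm_num))
  have hK0 : 0 ≤ K := (norm_nonneg _).trans (hK 0)
  refine ⟨K + 1, by linarith, fun Y r hr => ?_⟩
  have hm : ContDiff ℝ 1 (fun x : EuclideanSpace ℝ (Fin n) => r⁻¹ • (x - Y)) :=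
    ContDiff.const_smul r⁻¹ (contDiff_id.sub contDiff_const)
  have hη : ContDiff ℝ 1 (fun x : EuclideanSpace ℝ (Fin n) => 1 - b (r⁻¹ • (x - Y))) :=
    contDiff_const.sub (hbs.comp hm)
  have hn : ∀ x : EuclideanSpace ℝ (Fin n), dist (r⁻¹ • (x - Y)) 0 = dist x Y / r := by
    intro x
    rw [dist_zero_right, norm_smul, norm_inv, Real.norm_eq_abs, abs_of_pos hr, dist_eq_norm]
    field_simp
  have h1 : ∀ x, x ∉ ball Y (2 * r) → 1 - b (r⁻¹ • (x - Y)) = 1 := by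
    intro x hx
    rw [b.zero_of_le_dist, sub_zero]
    rw [hn]
    change 2 ≤ _
    rw [le_div_iff₀ hr]
    simpa using hx
  refine ⟨fun x => 1 - b (r⁻¹ • (x - Y)), hη, ?_, ?_, ?_, h1, ?_, ?_⟩
  · intro x; have := b.le_one (x := r⁻¹ • (x - Y)); simp only; linarith
  · intro x; have := b.nonneg (x := r⁻¹ • (x - Y)); simp only; linarith
  · intro x hx
    simp only
    rw [b.one_of_mem_closedBall, sub_self]
    rw [mem_closedBall, hn]
    change _ ≤ (1 : ℝ)
    rw [div_le_iff₀ hr, one_mul]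
    exact (mem_ball.1 hx).le
  · intro x
    have d1 : HasFDerivAt (fun x : EuclideanSpace ℝ (Fin n) => r⁻¹ • (x - Y))
        (r⁻¹ • ContinuousLinearMap.id ℝ (EuclideanSpace ℝ (Fin n))) x :=
      ((hasFDerivAt_id x).sub_const Y).const_smul r⁻¹
    have d2 := (hbs.differentiable (by norm_num) (r⁻¹ • (x - Y))).hasFDerivAt
    have d3 := (d2.comp x d1).const_sub 1
    have d4 : fderiv ℝ (fun x : EuclideanSpace ℝ (Fin n) => 1 - b (r⁻¹ • (x - Y))) x =
      -(fderiv ℝ b (r⁻¹ • (x - Y)) ∘L (r⁻¹ • ContinuousLinearMap.id ℝ _)) := d3.fderiv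
    rw [d4, norm_neg]
    refine (ContinuousLinearMap.opNorm_comp_le _ _).trans ?_
    have e1 : ‖r⁻¹ • ContinuousLinearMap.id ℝ (EuclideanSpace ℝ (Fin n))‖ ≤ r⁻¹ := by
      rw [norm_smul, norm_inv, Real.norm_eq_abs, abs_of_pos hr]
      have := ContinuousLinearMap.norm_id_le (𝕜 := ℝ) (E := EuclideanSpace ℝ (Fin n))
      have h3 : 0 < r⁻¹ := by positivity
      nlinarith
    rw [div_eq_mul_inv]
    have := hK (r⁻¹ • (x - Y))
    exact mul_le_mul (by linarith) e1 (norm_nonneg _) (by linarith)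
  · intro x hx
    apply IsLocalMax.fderiv_eq_zero
    refine Filter.Eventually.of_forall fun y => ?_
    simp only
    rw [h1 x hx]
    have := b.nonneg (x := r⁻¹ • (y - Y)); linarith

lemma fd_prod {n : ℕ} {u η : EuclideanSpace ℝ (Fin n) → ℝ} {x : EuclideanSpace ℝ (Fin n)}
    (hu : DifferentiableAt ℝ u x) (hη : DifferentiableAt ℝ η x) :
    fderiv ℝ (fun x => u x * (η x * η x)) x =
      (η x * η x) • fderiv ℝ u x + (2 * u x * η x) • fderiv ℝ η x := by
  rw [fderiv_fun_mul hu (hη.fun_mul hη), fderiv_fun_mul hη hη]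
  module

lemma main_ineq {n : ℕ} (hn : 3 ≤ n) {K : ℝ} {M Cσ d cd : ℝ}
    {Ω : Set (EuclideanSpace ℝ (Fin n))}
    {σ : Measure (EuclideanSpace ℝ (Fin n))} (hp : IsMixedPair M Cσ d cd Ω σ)
    {a : ℝ} (ha : 0 < a) {Y : EuclideanSpace ℝ (Fin n)} (hY : Y ∈ Ω)
    {u : EuclideanSpace ℝ (Fin n) → ℝ} (hu : IsRobinPoleSolution Ω σ a Y u)
    {r : ℝ} (hr : 0 < r) (hrd : r < diam Ω)
    {η : EuclideanSpace ℝ (Fin n) → ℝ} (hη : ContDiff ℝ 1 η) (hη0 : ∀ x, 0 ≤ η x)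
    (hη1 : ∀ x, η x ≤ 1) (hηb : ∀ x ∈ ball Y r, η x = 0)
    (hηo : ∀ x, x ∉ ball Y (2 * r) → η x = 1) (hηd : ∀ x, ‖fderiv ℝ η x‖ ≤ K / r)
    (hηz : ∀ x, x ∉ ball Y (2 * r) → fderiv ℝ η x = 0) :
    (∫ X in (Ω \ ball Y (2 * r)), ‖gradient u X‖ ^ 2) ≤
      4 * K ^ 2 / r ^ 2 * ∫ X in ((Ω ∩ ball Y (2 * r)) \ ball Y r), u X ^ 2 := by
  have hΩ := hp.nta.isOpen
  have hb := hp.bounded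
  haveI : NeZero n := ⟨by omega⟩
  have hne : (frontier Ω).Nonempty := by
    rw [nonempty_frontier_iff]
    refine ⟨hp.nonempty, fun hh => ?_⟩
    rw [hh] at hb
    exact NormedSpace.unbounded_univ ℝ (EuclideanSpace ℝ (Fin n)) hb
  have hdiam : 0 < diam Ω := hr.trans hrd
  have hfY : ∀ x ∈ frontier Ω, x ≠ Y := by
    rintro x hx rfl
    rw [hΩ.frontier_eq] at hx; exact hx.2 hY
  have huf : ContinuousOn u (frontier Ω) :=
    hu.contOn.mono fun x hx => ⟨frontier_subset_closure hx, hfY x hx⟩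
  set w : EuclideanSpace ℝ (Fin n) → ℝ := fun x => u x * (η x * η x) with hw
  have hw0 : ∀ x ∈ ball Y r, w x = 0 := fun x hx => by simp [hw, hηb x hx]
  have hwe : w =ᶠ[𝓝 Y] fun _ => 0 := by
    filter_upwards [ball_mem_nhds Y hr] with x hx using hw0 x hx
  have huC : ∀ x ∈ Ω, x ≠ Y → ContDiffAt ℝ 1 u x := fun x hx hxY =>
    (hu.harmonic x ⟨hx, hxY⟩).1.of_le (by norm_num)
  have hwc : ContinuousOn w (closure Ω) := by
    intro x hx
    by_cases hxY : x = Y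
    · subst hxY
      exact (continuousAt_const.congr hwe.symm).continuousWithinAt
    · have h1 : ContinuousWithinAt u (closure Ω) x :=
        (hu.contOn x ⟨hx, hxY⟩).mono_of_mem_nhdsWithin (Filter.inter_mem self_mem_nhdsWithin
          (mem_nhdsWithin_of_mem_nhds (isOpen_compl_singleton.mem_nhds hxY)))
      have h2 : ContinuousWithinAt η (closure Ω) x := hη.continuous.continuousWithinAt
      exact h1.mul (h2.mul h2)
  have hwC : ∀ x ∈ Ω, ContDiffAt ℝ 1 w x := by
    intro x hx
    by_cases hxY : x = Y
    · subst hxY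
      exact contDiffAt_const.congr_of_eventuallyEq hwe
    · exact (huC x hx hxY).mul (hη.contDiffAt.mul hη.contDiffAt)
  have hwd : ∀ x ∈ Ω, x ∉ ball Y r → fderiv ℝ w x =
      (η x * η x) • fderiv ℝ u x + (2 * u x * η x) • fderiv ℝ η x := by
    intro x hx hxb
    have hxY : x ≠ Y := by rintro rfl; exact hxb (mem_ball_self hr)
    exact fd_prod ((huC x hx hxY).differentiableAt (by norm_num))
      (hη.differentiable (by norm_num) x)
  have hcpt : IsCompact (closure Ω \ ball Y r) :=
    (Metric.isCompact_of_isClosed_isBounded isClosed_closure hb.closure).diff isOpen_ball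
  have hucc : ContinuousOn u (closure Ω \ ball Y r) := hu.contOn.mono fun x hx =>
    ⟨hx.1, by rintro rfl; exact hx.2 (mem_ball_self hr)⟩
  obtain ⟨B, hB⟩ := hcpt.exists_bound_of_continuousOn hucc
  have iu : IntegrableOn (fun x => u x ^ 2) (closure Ω \ ball Y r) volume :=
    cont_int hcpt hcpt.measure_lt_top.ne (hucc.pow 2)
  have iG := int_outer (hu.grad_L2 r hr)
  have iG2 := int_outer (hu.grad_L2 (2 * r) (by linarith))
  have icst : IntegrableOn (fun _ : EuclideanSpace ℝ (Fin n) => 8 * B ^ 2 * (K / r) ^ 2) Ω volume :=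
    integrableOn_const hb.measure_lt_top.ne
  have hw2 : IntegrableOn (fun x => ‖fderiv ℝ w x‖ ^ 2) Ω volume := by
    refine Integrable.mono' ((iG.const_mul 2).add icst)
      ((measurable_fderiv ℝ w).norm.pow_const 2).aestronglyMeasurable ?_
    filter_upwards [ae_restrict_mem hΩ.measurableSet] with x hx
    rw [Real.norm_eq_abs, abs_of_nonneg (by positivity)]
    simp only [Pi.add_apply]
    by_cases hxb : x ∈ ball Y r
    · rw [fderiv_zero_ball hw0 x hxb, indicator_of_notMem (by simpa using hxb)]
      rw [norm_zero, mul_zero, zero_add, zero_pow two_ne_zero]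
      positivity
    · rw [indicator_of_mem (by simpa using hxb), norm_gradient, hwd x hx hxb]
      have b1 : |u x| ≤ B := hB x ⟨subset_closure hx, hxb⟩
      have b2 := norm_add_le ((η x * η x) • fderiv ℝ u x) ((2 * u x * η x) • fderiv ℝ η x)
      rw [norm_smul, norm_smul, Real.norm_eq_abs, Real.norm_eq_abs, abs_mul, abs_mul, abs_mul,
        abs_of_nonneg (hη0 x), abs_of_pos (show (0 : ℝ) < 2 by norm_num)] at b2
      have b3 : η x * η x * ‖fderiv ℝ u x‖ ≤ ‖fderiv ℝ u x‖ := by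
        have : η x * η x ≤ 1 := mul_le_one₀ (hη1 x) (hη0 x) (hη1 x)
        exact mul_le_of_le_one_left (norm_nonneg _) this
      have b4 : 2 * |u x| * η x * ‖fderiv ℝ η x‖ ≤ 2 * B * (K / r) := by
        refine mul_le_mul ?_ (hηd x) (norm_nonneg _) (by linarith [abs_nonneg (u x)])
        have := mul_le_of_le_one_right (show 0 ≤ 2 * |u x| by positivity) (hη1 x)
        linarith
      have b5 := b2.trans (add_le_add b3 b4)
      have b6 := pow_le_pow_left₀ (norm_nonneg _) b5 2
      refine b6.trans ?_
      nlinarith [sq_nonneg (‖fderiv ℝ u x‖ - 2 * B * (K / r))]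
  have hweak := weakW hp.nta hb hne hdiam hp.finite ha huf hY hr hu.grad_L2 hu.weak hwc hwC hw0 hw2
  rw [wform] at hweak
  have hbd : 0 ≤ a * ∫ p in frontier Ω, u p * w p ∂σ := by
    refine mul_nonneg ha.le (integral_nonneg fun x => ?_)
    have : u x * w x = (u x * η x) ^ 2 := by simp only [hw]; ring
    simp only [Pi.zero_apply, this]; positivity
  have i1 := int_pair hΩ (hu.grad_L2 r hr) hw0 hw2
  set A : Set (EuclideanSpace ℝ (Fin n)) := ball Y (2 * r) \ ball Y r with hA
  have hAm : MeasurableSet A := measurableSet_ball.diff measurableSet_ball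
  have iA : IntegrableOn (A.indicator fun x => u x ^ 2) Ω volume := by
    rw [IntegrableOn, integrable_indicator_iff hAm, IntegrableOn, Measure.restrict_restrict hAm]
    exact iu.mono_set fun x hx => ⟨subset_closure hx.2, hx.1.2⟩
  have hpt : ∀ x ∈ Ω, (1 / 2) * (ball Y (2 * r))ᶜ.indicator (fun x => ‖gradient u x‖ ^ 2) x -
      2 * (K / r) ^ 2 * A.indicator (fun x => u x ^ 2) x ≤ fderiv ℝ w x (gradient u x) := by
    intro x hx
    by_cases hxb : x ∈ ball Y r
    · have hx2 : x ∈ ball Y (2 * r) := ball_subset_ball (by linarith) hxb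
      rw [fderiv_zero_ball hw0 x hxb, indicator_of_notMem (by simpa using hx2),
        indicator_of_notMem (by simp only [hA, mem_sdiff, not_and, not_not]; exact fun _ => hxb)]
      simp
    · rw [hwd x hx hxb]
      have hD : fderiv ℝ u x (gradient u x) = ‖gradient u x‖ ^ 2 := by
        rw [fderiv_gradient, real_inner_self_eq_norm_sq]
      simp only [add_apply, smul_apply, smul_eq_mul, hD]
      by_cases hx2 : x ∈ ball Y (2 * r)
      · rw [indicator_of_notMem (by simpa using hx2), indicator_of_mem (show x ∈ A from ⟨hx2, hxb⟩)]
        have o := (fderiv ℝ η x).le_opNorm (gradient u x)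
        rw [Real.norm_eq_abs] at o
        have o2 := o.trans (mul_le_mul_of_nonneg_right (hηd x) (norm_nonneg _))
        set g := ‖gradient u x‖
        set D := fderiv ℝ η x (gradient u x)
        have o3 : |2 * u x * η x * D| ≤ 2 * |u x| * η x * (K / r * g) := by
          rw [abs_mul, abs_mul, abs_mul, abs_of_nonneg (hη0 x),
            abs_of_pos (show (0 : ℝ) < 2 by norm_num)]
          exact mul_le_mul_of_nonneg_left o2
            (mul_nonneg (by positivity) (hη0 x))
        have o4 := neg_abs_le (2 * u x * η x * D)
        have o5 : 2 * |u x| * η x * (K / r * g) ≤ η x * η x * g ^ 2 + (K / r) ^ 2 * |u x| ^ 2 := by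
          nlinarith [sq_nonneg (η x * g - K / r * |u x|)]
        rw [sq_abs] at o5
        have o6 : 0 ≤ (K / r) ^ 2 * u x ^ 2 := by positivity
        linarith
      · rw [indicator_of_mem (by simpa using hx2),
          indicator_of_notMem (by simp only [hA, mem_sdiff, not_and]; exact fun h => absurd h hx2),
          hηz x hx2, hηo x hx2]
        simp only [zero_apply]
        nlinarith [sq_nonneg ‖gradient u x‖]
  have hmono := setIntegral_mono_on ((iG2.const_mul (1 / 2)).sub (iA.const_mul (2 * (K / r) ^ 2)))
    i1 hΩ.measurableSet hpt
  have e0 : ∫ x in Ω, ((1 / 2) * (ball Y (2 * r))ᶜ.indicator (fun x => ‖gradient u x‖ ^ 2) x -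
      2 * (K / r) ^ 2 * A.indicator (fun x => u x ^ 2) x) =
      (1 / 2) * (∫ x in Ω \ ball Y (2 * r), ‖gradient u x‖ ^ 2) -
      2 * (K / r) ^ 2 * ∫ x in ((Ω ∩ ball Y (2 * r)) \ ball Y r), u x ^ 2 := by
    rw [integral_sub (iG2.const_mul (1 / 2)) (iA.const_mul (2 * (K / r) ^ 2)), integral_const_mul,
      integral_const_mul, setIntegral_indicator measurableSet_ball.compl,
      setIntegral_indicator hAm, hA, ← inter_sdiff_assoc, ← sdiff_eq]
  have hmono' := e0.symm.le.trans hmono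
  have e1 : 4 * K ^ 2 / r ^ 2 = 4 * (K / r) ^ 2 := by rw [div_pow]; ring
  rw [e1]
  linarith

end RobinCacc

/-- Caccioppoli inequality on exterior regions for solutions with a pole and
vanishing Robin condition, with a constant depending only on `n`. -/
theorem stmt_9 (n : ℕ) (hn : 3 ≤ n) :
    ∃ C : ℝ, 0 < C ∧
      ∀ (M Cσ d cd : ℝ) (Ω : Set (EuclideanSpace ℝ (Fin n)))
        (σ : MeasureTheory.Measure (EuclideanSpace ℝ (Fin n))),
        IsMixedPair M Cσ d cd Ω σ →
        ∀ a : ℝ, 0 < a → ∀ Y ∈ Ω,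
          ∀ u : EuclideanSpace ℝ (Fin n) → ℝ, IsRobinPoleSolution Ω σ a Y u →
            ∀ r : ℝ, 0 < r → r < Metric.diam Ω →
              (∫ X in (Ω \ Metric.ball Y (2 * r)), ‖gradient u X‖ ^ 2) ≤
                C / r ^ 2 * ∫ X in ((Ω ∩ Metric.ball Y (2 * r)) \ Metric.ball Y r), u X ^ 2 := by
  obtain ⟨K, hK, h⟩ := RobinCacc.cutoff n
  refine ⟨4 * K ^ 2, by positivity, ?_⟩
  intro M Cσ d cd Ω σ hp a ha Y hY u hu r hr hrd
  obtain ⟨η, h1, h2, h3, h4, h5, h6, h7⟩ := h Y r hr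
  exact RobinCacc.main_ineq hn hp ha hY hu hr hrd h1 h2 h3 h4 h5 h6 h7
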